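/- Assume γ/π is irrational and m¹ is reversible and ergodic with respect to q. Suppose F ⊂ E* is (m²,Q)-ergodic and 0 < m²(F) < 1. Then: (i) there exists a measurable set K ⊂ [−1,1] such that F equals V⁻¹(K) up to an m²-null set, where V(u,v,s) := s·|U_γ(u,v)|² and U_γ(u,v) := (u + v cos γ, v sin γ); (ii) F ∪ T₀(F) equals E* up to an m²-null set, and F ∩ T₀(F) is m²-null; (iii) m²(F) = m²(T₀(F)) = 1/2. -/

import Mathlib

open MeasureTheory ProbabilityTheory Set Pointwise
open scoped ENNReal

noncomputable section

/-- The increasing affine map from `(-1,1)` onto the chord `E_u`. -/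
def ellMap (γ u x : ℝ) : ℝ := -u * Real.cos γ + x * Real.sqrt (1 - u ^ 2 * Real.sin γ ^ 2)

/-- The inverse of `ellMap γ u`. -/
def ellInv (γ u y : ℝ) : ℝ := (y + u * Real.cos γ) / Real.sqrt (1 - u ^ 2 * Real.sin γ ^ 2)

/-- The open elliptical region `E`. -/
def Eset (γ : ℝ) : Set (ℝ × ℝ) :=
  {p | p.1 ^ 2 + 2 * Real.cos γ * p.1 * p.2 + p.2 ^ 2 < 1}

/-- The state space `E* = E × {−1,1}`, realized inside `ℝ × ℝ × ℝ`. -/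
def EstarSet (γ : ℝ) : Set (ℝ × ℝ × ℝ) :=
  {w | (w.1, w.2.1) ∈ Eset γ ∧ (w.2.2 = 1 ∨ w.2.2 = -1)}

/-- Uniform probability measure on `(-1,1)`. -/
def m1 : Measure ℝ := (2 : ℝ≥0∞)⁻¹ • volume.restrict (Ioo (-1 : ℝ) 1)

/-- The probability measure `m²` on `E*`: normalized Lebesgue measure on `E` times
uniform measure on `{−1,1}`. -/
def m2 (γ : ℝ) : Measure (ℝ × ℝ × ℝ) :=
  ((((volume (Eset γ))⁻¹ • volume.restrict (Eset γ)).prod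
      ((2 : ℝ≥0∞)⁻¹ • (Measure.dirac (1 : ℝ) + Measure.dirac (-1 : ℝ)))).map
    fun p => (p.1.1, p.1.2, p.2))

/-- `q` is a Markov kernel on `(-1,1)`. -/
def IsMarkovOnInterval (q : Kernel ℝ ℝ) : Prop :=
  IsMarkovKernel q ∧ ∀ x ∈ Ioo (-1 : ℝ) 1, q x (Ioo (-1 : ℝ) 1) = 1

/-- The kernel `Q` of the alternating random walk, as a measure-valued function on the
state space. -/
def Qfun (γ : ℝ) (q : Kernel ℝ ℝ) : ℝ × ℝ × ℝ → Measure (ℝ × ℝ × ℝ) := fun w =>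
  if w.2.2 = -1 then
    Measure.map (fun x => (ellMap γ w.2.1 x, w.2.1, (1 : ℝ))) (q (-ellInv γ w.2.1 w.1))
  else
    Measure.map (fun x => (w.1, ellMap γ w.1 x, (-1 : ℝ))) (q (-ellInv γ w.1 w.2.1))

/-- The kernel `Q†`. -/
def Qdag (γ : ℝ) (q : Kernel ℝ ℝ) : ℝ × ℝ × ℝ → Measure (ℝ × ℝ × ℝ) := fun w =>
  if w.2.2 = 1 then
    Measure.map (fun x => (ellMap γ w.2.1 x, w.2.1, (-1 : ℝ)))
      ((q (ellInv γ w.2.1 w.1)).map (fun y => -y))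
  else
    Measure.map (fun x => (w.1, ellMap γ w.1 x, (1 : ℝ)))
      ((q (ellInv γ w.1 w.2.1)).map (fun y => -y))

/-- Bounded continuous real-valued functions on a subset `S`. -/
def BddCtsOn {X : Type*} [TopologicalSpace X] (S : Set X) (f : X → ℝ) : Prop :=
  ContinuousOn f S ∧ ∃ C, ∀ x ∈ S, |f x| ≤ C

/-- `m¹` is a reversible measure for `q`. -/
def Reversible1 (q : Kernel ℝ ℝ) : Prop :=
  ∀ j k : ℝ → ℝ, BddCtsOn (Ioo (-1 : ℝ) 1) j → BddCtsOn (Ioo (-1 : ℝ) 1) k →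
    ∫ x, k x * ∫ y, j y ∂(q x) ∂m1 = ∫ x, j x * ∫ y, k y ∂(q x) ∂m1

/-- The `†`-operation on measure-valued functions on `(-1,1)`: `p†(x,A) := p(−x,−A)`. -/
def dag (p : ℝ → Measure ℝ) : ℝ → Measure ℝ := fun x => (p (-x)).map (fun y => -y)

/-- `m¹` is a `†`-reversible measure for `p`. -/
def DagReversible1 (p : ℝ → Measure ℝ) : Prop :=
  ∀ j k : ℝ → ℝ, BddCtsOn (Ioo (-1 : ℝ) 1) j → BddCtsOn (Ioo (-1 : ℝ) 1) k →
    ∫ x, k x * ∫ y, j y ∂(p x) ∂m1 = ∫ x, j x * ∫ y, k y ∂(dag p x) ∂m1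

/-- `m²` is a `†`-reversible measure for `Q`. -/
def DagReversible2 (γ : ℝ) (q : Kernel ℝ ℝ) : Prop :=
  ∀ f g : ℝ × ℝ × ℝ → ℝ, BddCtsOn (EstarSet γ) f → BddCtsOn (EstarSet γ) g →
    ∫ w, g w * ∫ w', f w' ∂(Qfun γ q w) ∂(m2 γ) =
      ∫ w, f w * ∫ w', g w' ∂(Qdag γ q w) ∂(m2 γ)

/-- `μ` is an invariant measure for the transition function `p`. -/
def KInvariantMeasure {S : Type*} [MeasurableSpace S] (μ : Measure S) (p : S → Measure S) :
    Prop :=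
  ∀ A : Set S, MeasurableSet A → ∫⁻ x, p x A ∂μ = μ A

/-- The set `A` is `(μ,p)`-invariant. -/
def KInvariantSet {S : Type*} [MeasurableSpace S] (μ : Measure S) (p : S → Measure S)
    (A : Set S) : Prop :=
  ∀ᵐ x ∂μ, x ∈ A → p x A = 1

/-- `μ` is an ergodic measure for the transition function `p`. -/
def KErgodicMeasure {S : Type*} [MeasurableSpace S] (μ : Measure S) (p : S → Measure S) :
    Prop :=
  KInvariantMeasure μ p ∧
    ∀ A : Set S, MeasurableSet A → KInvariantSet μ p A → μ A = 0 ∨ μ A = 1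

/-- The set `A` is `(μ,p)`-ergodic. -/
def KErgodicSet {S : Type*} [MeasurableSpace S] (μ : Measure S) (p : S → Measure S)
    (A : Set S) : Prop :=
  MeasurableSet A ∧ KInvariantSet μ p A ∧
    ∀ B : Set S, B ⊆ A → MeasurableSet B → KInvariantSet μ p B → μ B = 0 ∨ μ B = μ A

/-- `F⁺`: the slice of `F ⊆ E*` at `s = 1`. -/
def Fplus (F : Set (ℝ × ℝ × ℝ)) : Set (ℝ × ℝ) := {p | (p.1, p.2, (1 : ℝ)) ∈ F}

/-- `F⁻`: the slice of `F ⊆ E*` at `s = −1`. -/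
def Fminus (F : Set (ℝ × ℝ × ℝ)) : Set (ℝ × ℝ) := {p | (p.1, p.2, (-1 : ℝ)) ∈ F}

/-- `[G]^u ⊆ (−1,1)`. -/
def brU (γ : ℝ) (G : Set (ℝ × ℝ)) (u : ℝ) : Set ℝ :=
  {x | x ∈ Ioo (-1 : ℝ) 1 ∧ (u, ellMap γ u x) ∈ G}

/-- `[G]_v ⊆ (−1,1)`. -/
def brV (γ : ℝ) (G : Set (ℝ × ℝ)) (v : ℝ) : Set ℝ :=
  {x | x ∈ Ioo (-1 : ℝ) 1 ∧ (ellMap γ v x, v) ∈ G}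

/-- The map `T₀` on `E*`. -/
def T0 (γ : ℝ) (w : ℝ × ℝ × ℝ) : ℝ × ℝ × ℝ :=
  (-w.1 - 2 * w.2.1 * Real.cos γ, w.2.1, -w.2.2)

/-- The map `T₁` on `E*`. -/
def T1 (γ : ℝ) (w : ℝ × ℝ × ℝ) : ℝ × ℝ × ℝ :=
  (w.1, -w.2.1 - 2 * w.1 * Real.cos γ, -w.2.2)

/-- The linear map `U_γ` taking `E` to the unit disk. -/
def Ugamma (γ : ℝ) (p : ℝ × ℝ) : ℝ × ℝ := (p.1 + p.2 * Real.cos γ, p.2 * Real.sin γ)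

/-- `V(u,v,s) = s·|U_γ(u,v)|²`. -/
def Vfun (γ : ℝ) (w : ℝ × ℝ × ℝ) : ℝ :=
  w.2.2 * ((w.1 + w.2.1 * Real.cos γ) ^ 2 + (w.2.1 * Real.sin γ) ^ 2)

instance m1_prob : IsProbabilityMeasure m1 := by
  constructor
  simp only [m1, Measure.smul_apply, Measure.restrict_apply MeasurableSet.univ, univ_inter,
    Real.volume_Ioo, smul_eq_mul]
  norm_num
  rw [ENNReal.inv_mul_cancel] <;> simp

lemma rev_sets (q : Kernel ℝ ℝ) [IsMarkovKernel q] (hrev : Reversible1 q)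
    {A B : Set ℝ} (hA : MeasurableSet A) (hB : MeasurableSet B) :
    ∫⁻ x in A, q x B ∂m1 = ∫⁻ x in B, q x A ∂m1 := by
  have key : (m1 ⊗ₘ q) = (m1 ⊗ₘ q).map Prod.swap := by
    haveI : IsFiniteMeasure ((m1 ⊗ₘ q).map Prod.swap) := by
      infer_instance
    apply Measure.ext_of_integral_mul_boundedContinuousFunction
    intro f g
    rw [integral_map measurable_swap.aemeasurable]
    · have i1 : ∀ f g : BoundedContinuousFunction ℝ ℝ,
          Integrable (fun p : ℝ × ℝ => f p.1 * g p.2) (m1 ⊗ₘ q) := by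
        intro f g
        apply Integrable.of_bound (C := ‖f‖ * ‖g‖)
        · apply Continuous.aestronglyMeasurable
          fun_prop
        · filter_upwards with p
          rw [norm_mul]
          exact mul_le_mul (f.norm_coe_le_norm _) (g.norm_coe_le_norm _) (norm_nonneg _) (norm_nonneg _)
      have i2 : Integrable (fun p : ℝ × ℝ => f p.2 * g p.1) (m1 ⊗ₘ q) := by
        simpa [mul_comm] using i1 g f
      simp only [Prod.fst_swap, Prod.snd_swap]
      rw [Measure.integral_compProd (i1 f g), Measure.integral_compProd i2]
      have := hrev g f ⟨g.continuous.continuousOn, ‖g‖, fun x _ => g.norm_coe_le_norm x⟩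
        ⟨f.continuous.continuousOn, ‖f‖, fun x _ => f.norm_coe_le_norm x⟩
      simp only [integral_const_mul, integral_mul_const]
      rw [this]
      congr 1
      ext x
      ring
    · apply Continuous.aestronglyMeasurable
      fun_prop
  have h2 := congrArg (fun μ => μ (A ×ˢ B)) key
  beta_reduce at h2
  rw [Measure.map_apply measurable_swap (hA.prod hB), Set.preimage_swap_prod,
    Measure.compProd_apply_prod hA hB, Measure.compProd_apply_prod hB hA] at h2
  exact h2

lemma q_le {q : Kernel ℝ ℝ} (herg : KErgodicMeasure m1 (fun x => q x))
    {A B : Set ℝ} (hA : MeasurableSet A) (hB : MeasurableSet B)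
    (h : ∀ᵐ x ∂m1, x ∈ A → q x B = 1) : m1 A ≤ m1 B := by
  rw [← herg.1 B hB]
  calc m1 A = ∫⁻ x in A, 1 ∂m1 := by simp
    _ = ∫⁻ x in A, q x B ∂m1 := by
        apply lintegral_congr_ae
        rw [Filter.EventuallyEq, ae_restrict_iff' hA]
        filter_upwards [h] with x hx hxA using (hx hxA).symm
    _ ≤ _ := setLIntegral_le_lintegral _ _

lemma q_back {q : Kernel ℝ ℝ} [IsMarkovKernel q] (hrev : Reversible1 q)
    {A B : Set ℝ} (hA : MeasurableSet A) (hB : MeasurableSet B)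
    (h : ∀ᵐ x ∂m1, x ∈ A → q x B = 1) (he : m1 A = m1 B) :
    ∀ᵐ x ∂m1, x ∈ B → q x A = 1 := by
  have h1 : ∫⁻ x in A, q x B ∂m1 = m1 A := by
    calc ∫⁻ x in A, q x B ∂m1 = ∫⁻ x in A, 1 ∂m1 := by
          apply lintegral_congr_ae
          rw [Filter.EventuallyEq, ae_restrict_iff' hA]
          filter_upwards [h] with x hx hxA using (hx hxA)
      _ = _ := by simp
  rw [rev_sets q hrev hA hB] at h1
  have h2 : (fun x => q x A) =ᵐ[m1.restrict B] fun _ => 1 := by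
    apply ae_eq_of_ae_le_of_lintegral_le
    · filter_upwards with x using prob_le_one
    · rw [h1]; exact measure_ne_top _ _
    · exact aemeasurable_const
    · rw [h1]; simp [he]
  rw [Filter.EventuallyEq, ae_restrict_iff' hB] at h2
  exact h2

lemma q_congr {q : Kernel ℝ ℝ} (herg : KErgodicMeasure m1 (fun x => q x))
    {A B : Set ℝ} (hA : MeasurableSet A) (hB : MeasurableSet B) (h : A =ᵐ[m1] B) :
    ∀ᵐ x ∂m1, q x A = q x B := by
  have hN : MeasurableSet (symmDiff A B) := hA.symmDiff hB
  have h0 := herg.1 _ hN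
  rw [measure_symmDiff_eq_zero_iff.2 h, lintegral_eq_zero_iff (q.measurable_coe hN)] at h0
  filter_upwards [h0] with x hx
  exact measure_congr (measure_symmDiff_eq_zero_iff.1 hx)

def Sw (q : Kernel ℝ ℝ) (H : Set ℝ) : Prop :=
  (∀ᵐ x ∂m1, x ∈ H → q x Hᶜ = 1) ∧ (∀ᵐ x ∂m1, x ∈ Hᶜ → q x H = 1)

lemma inter_one {μ : Measure ℝ} [IsProbabilityMeasure μ] {A B : Set ℝ} 
    (hA : MeasurableSet A) (hB : MeasurableSet B)
    (h1 : μ A = 1) (h2 : μ B = 1) : μ (A ∩ B) = 1 := by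
  rw [← prob_compl_eq_zero_iff (hA.inter hB), compl_inter]
  exact measure_union_null ((prob_compl_eq_zero_iff hA).2 h1) ((prob_compl_eq_zero_iff hB).2 h2)

lemma union_one {μ : Measure ℝ} [IsProbabilityMeasure μ] {A B : Set ℝ} 
    (h1 : μ A = 1) : μ (A ∪ B) = 1 :=
  le_antisymm prob_le_one (h1 ▸ measure_mono subset_union_left)

lemma one_ae {A : Set ℝ} (hA : MeasurableSet A) (h : m1 A = 1) : A =ᵐ[m1] univ := by
  rw [← prob_compl_eq_zero_iff hA] at h
  exact ae_eq_univ.2 h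

lemma tri {q : Kernel ℝ ℝ} [IsMarkovKernel q] (hrev : Reversible1 q)
    (herg : KErgodicMeasure m1 (fun x => q x))
    {A B : Set ℝ} (hA : MeasurableSet A) (hB : MeasurableSet B)
    (h : ∀ᵐ x ∂m1, x ∈ A → q x B = 1) (he : m1 A = m1 B) :
    (A =ᵐ[m1] (∅ : Set ℝ) ∧ B =ᵐ[m1] (∅ : Set ℝ)) ∨ (A =ᵐ[m1] univ ∧ B =ᵐ[m1] univ) ∨
      (A =ᵐ[m1] (Bᶜ : Set ℝ) ∧ Sw q B) := by
  have hb := q_back hrev hA hB h he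
  have hu := herg.2 (A ∪ B) (hA.union hB) (by
    filter_upwards [h, hb] with x h1 h2 hx
    rcases hx with hx | hx
    · rw [union_comm]; exact union_one (h1 hx)
    · exact union_one (h2 hx))
  have hi := herg.2 (A ∩ B) (hA.inter hB) (by
    filter_upwards [h, hb] with x h1 h2 hx
    exact inter_one hA hB (h2 hx.2) (h1 hx.1))
  rcases hi with hi | hi
  · rcases hu with hu | hu
    · left
      exact ⟨ae_eq_empty.2 (measure_mono_null subset_union_left hu),
        ae_eq_empty.2 (measure_mono_null subset_union_right hu)⟩
    · right; right
      have hAB : A =ᵐ[m1] (Bᶜ : Set ℝ) := by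
        have e1 := ae_eq_empty.2 hi
        have e2 := one_ae (hA.union hB) hu
        filter_upwards [e1.mem_iff, e2.mem_iff] with x e1 e2
        apply propext
        change x ∈ A ↔ x ∈ Bᶜ
        simp only [mem_inter_iff, mem_union, mem_univ, mem_empty_iff_false, mem_compl_iff] at *
        tauto
      refine ⟨hAB, ?_, ?_⟩
      · filter_upwards [hb, q_congr herg hA hB.compl hAB] with x h1 h2 hx
        rw [← h2]; exact h1 hx
      · filter_upwards [h, hAB.mem_iff] with x h1 h2 hx
        exact h1 (h2.2 hx)
  · right; left
    exact ⟨one_ae hA (le_antisymm prob_le_one (hi ▸ measure_mono inter_subset_left)),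
      one_ae hB (le_antisymm prob_le_one (hi ▸ measure_mono inter_subset_right))⟩

def Ty (H B : Set ℝ) : Prop :=
  B =ᵐ[m1] (∅ : Set ℝ) ∨ B =ᵐ[m1] univ ∨ B =ᵐ[m1] H ∨ B =ᵐ[m1] (Hᶜ : Set ℝ)

lemma Sw_half {q : Kernel ℝ ℝ} (herg : KErgodicMeasure m1 (fun x => q x))
    {H : Set ℝ} (hH : MeasurableSet H) (h : Sw q H) : m1 H = m1 Hᶜ :=
  le_antisymm (q_le herg hH hH.compl h.1) (q_le herg hH.compl hH h.2)

lemma Sw_unique {q : Kernel ℝ ℝ} [IsMarkovKernel q] (herg : KErgodicMeasure m1 (fun x => q x))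
    {H B : Set ℝ} (hH : MeasurableSet H) (hB : MeasurableSet B) (h : Sw q H) (h' : Sw q B) :
    B =ᵐ[m1] H ∨ B =ᵐ[m1] (Hᶜ : Set ℝ) := by
  have hm : MeasurableSet ((H ∩ B) ∪ (Hᶜ ∩ Bᶜ)) :=
    (hH.inter hB).union (hH.compl.inter hB.compl)
  rcases herg.2 _ hm (by
    filter_upwards [h.1, h.2, h'.1, h'.2] with x a1 a2 b1 b2 hx
    rcases hx with hx | hx
    · rw [union_comm]; exact union_one (inter_one hH.compl hB.compl (a1 hx.1) (b1 hx.2))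
    · exact union_one (inter_one hH hB (a2 hx.1) (b2 hx.2))) with h0 | h0
  · right
    filter_upwards [(ae_eq_empty.2 h0).mem_iff] with x hx
    apply propext
    change x ∈ B ↔ x ∈ Hᶜ
    simp only [mem_inter_iff, mem_union, mem_empty_iff_false, mem_compl_iff] at *
    tauto
  · left
    filter_upwards [(one_ae hm h0).mem_iff] with x hx
    apply propext
    change x ∈ B ↔ x ∈ H
    simp only [mem_inter_iff, mem_union, mem_univ, mem_compl_iff] at *
    tauto

lemma exists_H {q : Kernel ℝ ℝ} [IsMarkovKernel q] (hrev : Reversible1 q)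
    (herg : KErgodicMeasure m1 (fun x => q x)) :
    ∃ H : Set ℝ, MeasurableSet H ∧ m1 H = m1 Hᶜ ∧ ∀ A B : Set ℝ, MeasurableSet A →
      MeasurableSet B → (∀ᵐ x ∂m1, x ∈ A → q x B = 1) → m1 A = m1 B → Ty H A ∧ Ty H B := by
  by_cases hex : ∃ H, MeasurableSet H ∧ Sw q H
  · obtain ⟨H, hH, hs⟩ := hex
    refine ⟨H, hH, Sw_half herg hH hs, ?_⟩
    intro A B hA hB h he
    rcases tri hrev herg hA hB h he with ⟨h1, h2⟩ | ⟨h1, h2⟩ | ⟨h1, h2⟩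
    · exact ⟨Or.inl h1, Or.inl h2⟩
    · exact ⟨Or.inr (Or.inl h1), Or.inr (Or.inl h2)⟩
    · rcases Sw_unique herg hH hB hs h2 with h3 | h3
      · exact ⟨Or.inr (Or.inr (Or.inr (h1.trans h3.compl))), Or.inr (Or.inr (Or.inl h3))⟩
      · refine ⟨Or.inr (Or.inr (Or.inl (h1.trans ?_))), Or.inr (Or.inr (Or.inr h3))⟩
        simpa using h3.compl
  · refine ⟨Ioi 0, measurableSet_Ioi, ?_, ?_⟩
    · have e1 : Ioi (0 : ℝ) ∩ Ioo (-1) 1 = Ioo 0 1 := by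
        ext x; simp only [mem_inter_iff, mem_Ioi, mem_Ioo]; constructor <;> intro h <;> grind
      have e2 : (Ioi (0 : ℝ))ᶜ ∩ Ioo (-1) 1 = Ioc (-1) 0 := by
        ext x; simp only [mem_inter_iff, mem_compl_iff, mem_Ioi, mem_Ioo, mem_Ioc]
        constructor <;> intro h <;> grind
      simp only [m1, Measure.smul_apply]
      rw [Measure.restrict_apply measurableSet_Ioi, Measure.restrict_apply measurableSet_Ioi.compl,
        e1, e2]
      simp
    · intro A B hA hB h he
      rcases tri hrev herg hA hB h he with ⟨h1, h2⟩ | ⟨h1, h2⟩ | ⟨h1, h2⟩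
      · exact ⟨Or.inl h1, Or.inl h2⟩
      · exact ⟨Or.inr (Or.inl h1), Or.inr (Or.inl h2)⟩
      · exact absurd ⟨B, hB, h2⟩ hex

def Vs (γ : ℝ) : Set ℝ := {v | v ^ 2 * Real.sin γ ^ 2 < 1}

lemma Vs_open (γ : ℝ) : IsOpen (Vs γ) := isOpen_lt (by fun_prop) (by fun_prop)

lemma Eset_open (γ : ℝ) : IsOpen (Eset γ) := isOpen_lt (by fun_prop) (by fun_prop)

lemma quad_eq (γ u v : ℝ) : u ^ 2 + 2 * Real.cos γ * u * v + v ^ 2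
    = (u + v * Real.cos γ) ^ 2 + v ^ 2 * Real.sin γ ^ 2 := by
  have := Real.sin_sq_add_cos_sq γ
  have h : Real.sin γ ^ 2 = 1 - Real.cos γ ^ 2 := by linarith
  rw [h]; ring

lemma Eset_snd {γ u v : ℝ} (h : (u, v) ∈ Eset γ) : v ∈ Vs γ := by
  simp only [Eset, mem_ofPred_eq] at h
  rw [quad_eq] at h
  simp only [Vs, mem_ofPred_eq]
  nlinarith [sq_nonneg (u + v * Real.cos γ)]

lemma Eset_swap {γ : ℝ} {p : ℝ × ℝ} : p.swap ∈ Eset γ ↔ p ∈ Eset γ := by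
  simp only [Eset, mem_ofPred_eq, Prod.fst_swap, Prod.snd_swap]
  constructor <;> intro h <;> nlinarith

lemma Vs_pos {γ v : ℝ} (h : v ∈ Vs γ) : 0 < Real.sqrt (1 - v ^ 2 * Real.sin γ ^ 2) :=
  Real.sqrt_pos.2 (by simp only [Vs, mem_ofPred_eq] at h; linarith)

lemma ell_mem {γ v x : ℝ} (h : v ∈ Vs γ) : (ellMap γ v x, v) ∈ Eset γ ↔ x ∈ Ioo (-1 : ℝ) 1 := by
  have h1 : 0 < 1 - v ^ 2 * Real.sin γ ^ 2 := by simp only [Vs, mem_ofPred_eq] at h; linarith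
  simp only [Eset, mem_ofPred_eq]
  rw [quad_eq, ellMap]
  have e : (-v * Real.cos γ + x * √(1 - v ^ 2 * Real.sin γ ^ 2) + v * Real.cos γ) ^ 2
      = x ^ 2 * (1 - v ^ 2 * Real.sin γ ^ 2) := by
    ring_nf
    rw [Real.sq_sqrt (by linarith)]; ring
  rw [e, mem_Ioo, ← abs_lt, ← sq_lt_one_iff_abs_lt_one]
  constructor
  · intro h2; by_contra h3; push Not at h3; nlinarith
  · intro h2; nlinarith

lemma ellInv_ellMap {γ v : ℝ} (h : v ∈ Vs γ) (x : ℝ) : ellInv γ v (ellMap γ v x) = x := by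
  have := Vs_pos h
  rw [ellInv, ellMap]; field_simp; ring

lemma ellMap_ellInv {γ v : ℝ} (h : v ∈ Vs γ) (u : ℝ) : ellMap γ v (ellInv γ v u) = u := by
  have := Vs_pos h
  rw [ellInv, ellMap]; field_simp; ring

lemma ell_meas (γ : ℝ) : Measurable (fun p : ℝ × ℝ => (ellMap γ p.1 p.2, p.1)) := by
  unfold ellMap; fun_prop

lemma line_vol {γ v : ℝ} (h : v ∈ Vs γ) (M : Set ℝ) (hM : M ⊆ {u | (u, v) ∈ Eset γ}) :
    volume M = ENNReal.ofReal (Real.sqrt (1 - v ^ 2 * Real.sin γ ^ 2)) * 2 *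
      m1 {x | ellMap γ v x ∈ M} := by
  have hp := Vs_pos h
  set r := Real.sqrt (1 - v ^ 2 * Real.sin γ ^ 2) with hr
  have hsub : {x | ellMap γ v x ∈ M} ⊆ Ioo (-1) 1 := fun x hx => (ell_mem h).1 (hM hx)
  have e0 : {x | ellMap γ v x ∈ M} = (fun x => x * r) ⁻¹' ((fun y => -v * Real.cos γ + y) ⁻¹' M) := by
    ext x; simp [ellMap, hr]
  have e1 : volume {x | ellMap γ v x ∈ M} = ENNReal.ofReal r⁻¹ * volume M := by
    rw [e0, Real.volume_preimage_mul_right hp.ne', measure_preimage_add, abs_of_pos (inv_pos.2 hp)]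
  have e2 : m1 {x | ellMap γ v x ∈ M} = 2⁻¹ * volume {x | ellMap γ v x ∈ M} := by
    rw [m1, Measure.smul_apply, Measure.restrict_eq_self _ hsub, smul_eq_mul]
  rw [e2, e1]
  rw [mul_assoc, ← mul_assoc 2, ENNReal.mul_inv_cancel (by simp) (by simp), one_mul, ← mul_assoc,
    ← ENNReal.ofReal_mul hp.le, mul_inv_cancel₀ hp.ne', ENNReal.ofReal_one, one_mul]

lemma vol_formula (γ : ℝ) {N : Set (ℝ × ℝ)} (hN : MeasurableSet N) (hs : N ⊆ Eset γ) :
    volume N = ∫⁻ v in Vs γ, ENNReal.ofReal (Real.sqrt (1 - v ^ 2 * Real.sin γ ^ 2)) * 2 *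
      m1 {x | (ellMap γ v x, v) ∈ N} := by
  rw [Measure.volume_eq_prod, Measure.prod_apply_symm hN, ← lintegral_indicator (Vs_open γ).measurableSet]
  congr 1
  ext v
  by_cases hv : v ∈ Vs γ
  · rw [indicator_of_mem hv]
    exact line_vol hv _ (fun u hu => hs hu)
  · rw [indicator_of_notMem hv]
    have : (fun x => (x, v)) ⁻¹' N = ∅ := by
      ext u; simp only [mem_preimage, mem_empty_iff_false, iff_false]
      intro h; exact hv (Eset_snd (hs h))
    rw [this, measure_empty]

lemma ell_sec_meas {γ : ℝ} {N : Set (ℝ × ℝ)} (hN : MeasurableSet N) :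
    Measurable (fun v => m1 {x | (ellMap γ v x, v) ∈ N}) :=
  measurable_measure_prodMk_left (ν := m1) (ell_meas γ hN)

lemma sec_meas {γ : ℝ} {N : Set (ℝ × ℝ)} (hN : MeasurableSet N) (v : ℝ) :
    MeasurableSet {x | (ellMap γ v x, v) ∈ N} :=
  ((ell_meas γ).comp (measurable_prodMk_left (x := v))) hN

lemma wt_meas (γ : ℝ) : Measurable
    (fun v => ENNReal.ofReal (Real.sqrt (1 - v ^ 2 * Real.sin γ ^ 2)) * 2) := by
  fun_prop

lemma wt_sec_meas {γ : ℝ} {N : Set (ℝ × ℝ)} (hN : MeasurableSet N) : Measurable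
    (fun v => ENNReal.ofReal (Real.sqrt (1 - v ^ 2 * Real.sin γ ^ 2)) * 2 *
      m1 {x | (ellMap γ v x, v) ∈ N}) :=
  (wt_meas γ).mul (ell_sec_meas hN)

lemma wt_ne {γ v : ℝ} (h : v ∈ Vs γ) :
    ENNReal.ofReal (Real.sqrt (1 - v ^ 2 * Real.sin γ ^ 2)) * 2 ≠ 0 := by
  have := Vs_pos h
  simp [this]

lemma null_iff (γ : ℝ) {N : Set (ℝ × ℝ)} (hN : MeasurableSet N) (hs : N ⊆ Eset γ) :
    volume N = 0 ↔ ∀ᵐ v, v ∈ Vs γ → m1 {x | (ellMap γ v x, v) ∈ N} = 0 := by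
  rw [vol_formula γ hN hs, lintegral_eq_zero_iff (wt_sec_meas hN),
    Filter.EventuallyEq, ae_restrict_iff' (Vs_open γ).measurableSet]
  apply Filter.eventually_congr
  filter_upwards with v
  apply imp_congr_right
  intro hv
  simp only [Pi.zero_apply, mul_eq_zero]
  constructor
  · rintro (h | h)
    · exact absurd (by simpa using h) (wt_ne hv)
    · exact h
  · intro h; right; exact h

/-- from a.e. on the ellipse to a.e. on lines -/
lemma ae_lines {γ : ℝ} {P : ℝ × ℝ → Prop} (h : ∀ᵐ p ∂volume.restrict (Eset γ), P p) :
    ∀ᵐ v, v ∈ Vs γ → ∀ᵐ x ∂m1, P (ellMap γ v x, v) := by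
  rw [ae_restrict_iff' (Eset_open γ).measurableSet, ae_iff] at h
  set N0 := {a | ¬(a ∈ Eset γ → P a)} with hN0
  have hN : MeasurableSet (toMeasurable volume N0 ∩ Eset γ) :=
    (measurableSet_toMeasurable _ _).inter (Eset_open γ).measurableSet
  have h2 : volume (toMeasurable volume N0 ∩ Eset γ) = 0 :=
    measure_mono_null inter_subset_left (by rw [measure_toMeasurable, h])
  rw [null_iff γ hN inter_subset_right] at h2
  filter_upwards [h2] with v hv hvs
  have hI : ∀ᵐ x ∂m1, x ∈ Ioo (-1 : ℝ) 1 := by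
    rw [m1]; exact Measure.ae_smul_measure (ae_restrict_mem measurableSet_Ioo) _
  have h3 := hv hvs
  rw [← compl_mem_ae_iff] at h3
  filter_upwards [h3, hI] with x hx hxI
  by_contra hP
  apply hx
  have hE := (ell_mem hvs).2 hxI
  refine ⟨subset_toMeasurable _ _ ?_, hE⟩
  simp only [hN0, mem_ofPred_eq]
  exact fun hh => hP (hh hE)

/-- from a.e. on lines to a.e. on the ellipse -/
lemma ae_of_lines {γ : ℝ} {P : ℝ × ℝ → Prop} (hP : MeasurableSet {p | P p})
    (h : ∀ᵐ v, v ∈ Vs γ → ∀ᵐ x ∂m1, P (ellMap γ v x, v)) :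
    ∀ᵐ p ∂volume.restrict (Eset γ), P p := by
  rw [ae_restrict_iff' (Eset_open γ).measurableSet, ae_iff]
  have e : {a | ¬(a ∈ Eset γ → P a)} = {p | P p}ᶜ ∩ Eset γ := by
    ext p; simp only [mem_ofPred_eq, mem_inter_iff, mem_compl_iff]; tauto
  rw [e, null_iff γ (hP.compl.inter (Eset_open γ).measurableSet) inter_subset_right]
  filter_upwards [h] with v hv hvs
  refine measure_mono_null ?_ (ae_iff.1 (hv hvs))
  intro x hx
  exact hx.1

lemma ae_swap {γ : ℝ} {P : ℝ × ℝ → Prop} (h : ∀ᵐ p ∂volume.restrict (Eset γ), P p) :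
    ∀ᵐ p ∂volume.restrict (Eset γ), P p.swap := by
  have h1 : MeasurePreserving Prod.swap (volume.restrict (Eset γ)) (volume.restrict (Eset γ)) := by
    have h2 : MeasurePreserving (Prod.swap : ℝ × ℝ → ℝ × ℝ) volume volume :=
      Measure.measurePreserving_swap
    have h3 := h2.restrict_preimage (Eset_open γ).measurableSet
    have e : Prod.swap ⁻¹' Eset γ = Eset γ := by ext p; exact Eset_swap
    rwa [e] at h3
  exact h1.quasiMeasurePreserving.ae h

lemma m1_neg : MeasurePreserving (fun x : ℝ => -x) m1 m1 := by
  have h2 : MeasurePreserving (fun x : ℝ => -x) volume volume := Measure.measurePreserving_neg _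
  have h3 := h2.restrict_preimage (measurableSet_Ioo (a := (-1 : ℝ)) (b := 1))
  have e : (fun x : ℝ => -x) ⁻¹' Ioo (-1) 1 = Ioo (-1) 1 := by
    ext x; simp only [mem_preimage, mem_Ioo]; constructor <;> intro h <;> constructor <;> linarith [h.1, h.2]
  rw [e] at h3
  exact h3.smul_measure _

lemma pair_ae {γ : ℝ} {q : Kernel ℝ ℝ} {Gm Gp : Set (ℝ × ℝ)}
    (h : ∀ᵐ p ∂volume.restrict (Eset γ), p ∈ Gm →
      q (-ellInv γ p.2 p.1) {x | (ellMap γ p.2 x, p.2) ∈ Gp} = 1) :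
    ∀ᵐ v, v ∈ Vs γ → ∀ᵐ x ∂m1, x ∈ {x | (ellMap γ v (-x), v) ∈ Gm} →
      q x {x | (ellMap γ v x, v) ∈ Gp} = 1 := by
  filter_upwards [ae_lines h] with v hv hvs
  have h1 := m1_neg.quasiMeasurePreserving.ae (hv hvs)
  filter_upwards [h1] with x hx hxA
  have := hx hxA
  simp only [ellInv_ellMap hvs, neg_neg] at this
  exact this

lemma secA_meas {γ : ℝ} {N : Set (ℝ × ℝ)} (hN : MeasurableSet N) (v : ℝ) :
    MeasurableSet {x | (ellMap γ v (-x), v) ∈ N} :=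
  measurable_neg (sec_meas (γ := γ) hN v)

lemma secA_eq {γ : ℝ} {N : Set (ℝ × ℝ)} (hN : MeasurableSet N) (v : ℝ) :
    m1 {x | (ellMap γ v (-x), v) ∈ N} = m1 {x | (ellMap γ v x, v) ∈ N} :=
  m1_neg.measure_preimage (sec_meas (γ := γ) hN v).nullMeasurableSet

lemma pair_le_ae {γ : ℝ} {q : Kernel ℝ ℝ} (herg : KErgodicMeasure m1 (fun x => q x))
    {Gm Gp : Set (ℝ × ℝ)}
    (hm : MeasurableSet Gm) (hp : MeasurableSet Gp)
    (h : ∀ᵐ p ∂volume.restrict (Eset γ), p ∈ Gm →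
      q (-ellInv γ p.2 p.1) {x | (ellMap γ p.2 x, p.2) ∈ Gp} = 1) :
    ∀ᵐ v, v ∈ Vs γ → m1 {x | (ellMap γ v x, v) ∈ Gm} ≤ m1 {x | (ellMap γ v x, v) ∈ Gp} := by
  filter_upwards [pair_ae h] with v hv hvs
  rw [← secA_eq hm]
  exact q_le herg (secA_meas hm v) (sec_meas hp v) (hv hvs)

lemma pair_le {γ : ℝ} {q : Kernel ℝ ℝ} (herg : KErgodicMeasure m1 (fun x => q x))
    {Gm Gp : Set (ℝ × ℝ)}
    (hm : MeasurableSet Gm) (hp : MeasurableSet Gp) (hms : Gm ⊆ Eset γ) (hps : Gp ⊆ Eset γ)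
    (h : ∀ᵐ p ∂volume.restrict (Eset γ), p ∈ Gm →
      q (-ellInv γ p.2 p.1) {x | (ellMap γ p.2 x, p.2) ∈ Gp} = 1) :
    volume Gm ≤ volume Gp := by
  rw [vol_formula γ hm hms, vol_formula γ hp hps]
  apply lintegral_mono_ae
  rw [ae_restrict_iff' (Vs_open γ).measurableSet]
  filter_upwards [pair_le_ae herg hm hp h] with v hv hvs
  exact mul_le_mul_right (hv hvs) _

lemma pair_eq_ae {γ : ℝ} {q : Kernel ℝ ℝ} (herg : KErgodicMeasure m1 (fun x => q x))
    {Gm Gp : Set (ℝ × ℝ)}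
    (hm : MeasurableSet Gm) (hp : MeasurableSet Gp) (hms : Gm ⊆ Eset γ) (hps : Gp ⊆ Eset γ)
    (h : ∀ᵐ p ∂volume.restrict (Eset γ), p ∈ Gm →
      q (-ellInv γ p.2 p.1) {x | (ellMap γ p.2 x, p.2) ∈ Gp} = 1)
    (hfin : volume Gm ≠ ∞) (he : volume Gm = volume Gp) :
    ∀ᵐ v, v ∈ Vs γ → m1 {x | (ellMap γ v x, v) ∈ Gm} = m1 {x | (ellMap γ v x, v) ∈ Gp} := by
  rw [vol_formula γ hm hms, vol_formula γ hp hps] at he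
  rw [vol_formula γ hm hms] at hfin
  have h1 := pair_le_ae herg hm hp h
  have h2 := ae_eq_of_ae_le_of_lintegral_le (μ := volume.restrict (Vs γ)) (by
    rw [Filter.EventuallyLE, ae_restrict_iff' (Vs_open γ).measurableSet]
    filter_upwards [h1] with v hv hvs
    exact mul_le_mul_right (hv hvs) (ENNReal.ofReal (Real.sqrt (1 - v ^ 2 * Real.sin γ ^ 2)) * 2))
    hfin (wt_sec_meas hp).aemeasurable he.ge
  rw [Filter.EventuallyEq, ae_restrict_iff' (Vs_open γ).measurableSet] at h2
  filter_upwards [h2] with v hv hvs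
  have := hv hvs
  rwa [ENNReal.mul_right_inj (wt_ne hvs) (by finiteness)] at this

lemma pair_Ty {γ : ℝ} {q : Kernel ℝ ℝ} (herg : KErgodicMeasure m1 (fun x => q x))
    {H : Set ℝ} (hH : ∀ A B : Set ℝ, MeasurableSet A →
      MeasurableSet B → (∀ᵐ x ∂m1, x ∈ A → q x B = 1) → m1 A = m1 B → Ty H A ∧ Ty H B)
    {Gm Gp : Set (ℝ × ℝ)}
    (hm : MeasurableSet Gm) (hp : MeasurableSet Gp) (hms : Gm ⊆ Eset γ) (hps : Gp ⊆ Eset γ)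
    (h : ∀ᵐ p ∂volume.restrict (Eset γ), p ∈ Gm →
      q (-ellInv γ p.2 p.1) {x | (ellMap γ p.2 x, p.2) ∈ Gp} = 1)
    (hfin : volume Gm ≠ ∞) (he : volume Gm = volume Gp) :
    ∀ᵐ v, v ∈ Vs γ → Ty H {x | (ellMap γ v (-x), v) ∈ Gm} ∧ Ty H {x | (ellMap γ v x, v) ∈ Gp} := by
  filter_upwards [pair_eq_ae herg hm hp hms hps h hfin he, pair_ae h] with v h1 h2 hvs
  exact hH _ _ (secA_meas hm v) (sec_meas hp v) (h2 hvs) (by rw [secA_eq hm, h1 hvs])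

/-- The sign function of `H`. -/
def sg (H : Set ℝ) (x : ℝ) : ℝ := H.indicator 2 x - 1

lemma sg_meas {H : Set ℝ} (hH : MeasurableSet H) : Measurable (sg H) :=
  (measurable_const.indicator hH).sub measurable_const

lemma sg_mem {H : Set ℝ} {x : ℝ} (h : x ∈ H) : sg H x = 1 := by simp [sg, h]; norm_num
lemma sg_notMem {H : Set ℝ} {x : ℝ} (h : x ∉ H) : sg H x = -1 := by simp [sg, h]
lemma sg_cases (H : Set ℝ) (x : ℝ) : sg H x = 1 ∨ sg H x = -1 := by
  by_cases h : x ∈ H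
  · exact Or.inl (sg_mem h)
  · exact Or.inr (sg_notMem h)
lemma sg_abs (H : Set ℝ) (x : ℝ) : |sg H x| ≤ 1 := by
  rcases sg_cases H x with h | h <;> simp [h]

lemma sg_int {H : Set ℝ} (hH : MeasurableSet H) (hh : m1 H = m1 Hᶜ) : ∫ x, sg H x ∂m1 = 0 := by
  have h1 : m1 H + m1 Hᶜ = 1 := prob_add_prob_compl hH
  have h2 : m1.real H = 1 / 2 := by
    have := congrArg ENNReal.toReal h1
    rw [ENNReal.toReal_add (measure_ne_top _ _) (measure_ne_top _ _), ← hh] at this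
    simp only [Measure.real]
    norm_num at this
    linarith
  unfold sg
  rw [integral_sub ((integrable_const _).indicator hH) (integrable_const _), 
    integral_indicator hH]
  simp [h2]

/-- Affine form of a set of type `H`. -/
lemma Ty_form {H B : Set ℝ} (hH : MeasurableSet H) (hh : m1 H = m1 Hᶜ) (h : Ty H B) :
    ∀ᵐ x ∂m1, B.indicator 1 x = ∫ y, B.indicator 1 y ∂m1 +
      (∫ y, B.indicator 1 y * sg H y ∂m1) * sg H x := by
  have i0 := sg_int hH hh
  have isg : Integrable (sg H) m1 := by
    apply Integrable.of_bound (C := 1) (sg_meas hH).aestronglyMeasurable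
    filter_upwards with x using sg_abs H x
  suffices hs : ∃ α β : ℝ, ∀ᵐ x ∂m1, B.indicator (1 : ℝ → ℝ) x = α + β * sg H x by
    obtain ⟨α, β, hs⟩ := hs
    have e1 : ∫ y, B.indicator (1 : ℝ → ℝ) y ∂m1 = α := by
      rw [integral_congr_ae hs, integral_add (integrable_const _) (isg.const_mul _),
        integral_const_mul, i0]
      simp
    have e2 : ∫ y, B.indicator (1 : ℝ → ℝ) y * sg H y ∂m1 = β := by
      have : (fun y => B.indicator (1 : ℝ → ℝ) y * sg H y) =ᵐ[m1] fun y => α * sg H y + β := by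
        filter_upwards [hs] with y hy
        rw [hy]
        rcases sg_cases H y with h | h <;> rw [h] <;> ring
      rw [integral_congr_ae this, integral_add (isg.const_mul _) (integrable_const _),
        integral_const_mul, i0]
      simp
    rw [e1, e2]; exact hs
  rcases h with h | h | h | h
  · refine ⟨0, 0, ?_⟩
    filter_upwards [h.mem_iff] with x hx
    simp only [mem_empty_iff_false, iff_false] at hx
    simp [hx]
  · refine ⟨1, 0, ?_⟩
    filter_upwards [h.mem_iff] with x hx
    simp only [mem_univ, iff_true] at hx
    simp [hx]
  · refine ⟨1/2, 1/2, ?_⟩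
    filter_upwards [h.mem_iff] with x hx
    by_cases hxH : x ∈ H
    · simp [hx, sg_mem, hxH]; norm_num
    · simp [hx, sg_notMem, hxH]
  · refine ⟨1/2, -1/2, ?_⟩
    filter_upwards [h.mem_iff] with x hx
    by_cases hxH : x ∈ H
    · simp [hx, sg_mem, hxH]; norm_num
    · simp [hx, sg_notMem, hxH]; norm_num

open Filter Topology in
lemma antilip {σ : ℝ × ℝ → ℝ} {x0 v0 D : ℝ} (h : ContDiffAt ℝ 1 σ (x0, v0))
    (hD : HasDerivAt (fun v => σ (x0, v)) D v0) (hD0 : D ≠ 0) :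
    ∃ ε > 0, ∃ κ > 0, ∀ x ∈ Metric.ball x0 ε, ∀ v ∈ Metric.ball v0 ε, ∀ v' ∈ Metric.ball v0 ε,
      κ * |v - v'| ≤ |σ (x, v) - σ (x, v')| := by
  have hs := h.hasStrictFDerivAt (by norm_num)
  set L := fderiv ℝ σ (x0, v0) with hL
  have hLD : L (0, 1) = D := by
    have h1 : HasDerivAt (fun v : ℝ => (x0, v)) ((0 : ℝ), (1 : ℝ)) v0 :=
      (hasDerivAt_const v0 x0).prodMk (hasDerivAt_id v0)
    have h2 := hs.hasFDerivAt.comp_hasDerivAt v0 h1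
    exact h2.unique hD
  have ho := hs.isLittleO.bound (c := |D| / 2) (by positivity)
  rw [Metric.eventually_nhds_iff] at ho
  obtain ⟨ε, hε, ho⟩ := ho
  refine ⟨ε, hε, |D| / 2, by positivity, ?_⟩
  intro x hx v hv v' hv'
  have := @ho ((x, v), (x, v')) (by
    rw [Metric.mem_ball] at hx hv hv'
    simp only [Prod.dist_eq]
    simp [hx, hv, hv'])
  simp only [Prod.mk_sub_mk, sub_self] at this
  have e1 : L (0, v - v') = (v - v') * D := by
    have : ((0 : ℝ), v - v') = (v - v') • ((0 : ℝ), (1 : ℝ)) := by simp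
    rw [this, map_smul, hLD, smul_eq_mul]
  have e2 : ‖((0 : ℝ), v - v')‖ = |v - v'| := by
    simp [Prod.norm_def]
  rw [e1, e2, Real.norm_eq_abs] at this
  have h3 : |(v - v') * D| ≤ |σ (x, v) - σ (x, v') - (v - v') * D| + |σ (x, v) - σ (x, v')| := by
    have := abs_sub (σ (x, v) - σ (x, v')) (σ (x, v) - σ (x, v') - (v - v') * D)
    rw [sub_sub_cancel] at this
    linarith
  rw [abs_mul] at h3
  nlinarith

lemma map_le {f : ℝ → ℝ} (hf : Measurable f) {I : Set ℝ} (hI : MeasurableSet I) {κ : ℝ}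
    (hκ : 0 < κ) (h : ∀ v ∈ I, ∀ v' ∈ I, κ * |v - v'| ≤ |f v - f v'|) :
    (volume.restrict I).map f ≤ ENNReal.ofReal κ⁻¹ • volume := by
  rw [Measure.le_iff]
  intro N hN
  rw [Measure.map_apply hf hN, Measure.restrict_apply (hf hN), Measure.smul_apply, smul_eq_mul]
  set S := f ⁻¹' N ∩ I with hS
  have hinj : InjOn f S := by
    intro v hv v' hv' e
    have := h v hv.2 v' hv'.2
    rw [e, sub_self, abs_zero] at this
    have h2 : |v - v'| ≤ 0 := by
      by_contra h3; push Not at h3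
      nlinarith
    linarith [abs_nonpos_iff.1 h2]
  set g := Function.invFunOn f S with hg
  have hgl : ∀ v ∈ S, g (f v) = v := hinj.leftInvOn_invFunOn
  have hlip : LipschitzOnWith (Real.toNNReal κ⁻¹) g (f '' S) := by
    apply LipschitzOnWith.of_dist_le_mul
    rintro _ ⟨v, hv, rfl⟩ _ ⟨v', hv', rfl⟩
    rw [hgl v hv, hgl v' hv', Real.dist_eq, Real.dist_eq,
      Real.coe_toNNReal _ (inv_nonneg.2 hκ.le)]
    have := h v hv.2 v' hv'.2
    rw [inv_mul_eq_div, le_div_iff₀ hκ]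
    linarith
  have h1 := hlip.hausdorffMeasure_image_le (d := 1) zero_le_one
  have e : g '' (f '' S) = S := by
    rw [image_image]
    ext v; constructor
    · rintro ⟨w, hw, rfl⟩; simp only [hgl w hw]; exact hw
    · intro hv; exact ⟨v, hv, hgl v hv⟩
  rw [e, hausdorffMeasure_real, ENNReal.rpow_one] at h1
  refine h1.trans ?_
  gcongr
  · exact le_refl _
  · rintro _ ⟨v, hv, rfl⟩; exact hv.1

open Filter Topology in
lemma L1_cont {k : ℝ → ℝ} (hk : Integrable k) (hkm : Measurable k) {I : Set ℝ}
    (hIf : volume I ≠ ∞) {σ : ℝ → ℝ → ℝ} {x0 : ℝ} {C : ℝ}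
    (hm : ∀ x, Measurable (σ x))
    (hle : ∀ᶠ x in 𝓝 x0, (volume.restrict I).map (σ x) ≤ ENNReal.ofReal C • volume)
    (hc : ∀ᵐ v ∂volume.restrict I, ContinuousAt (fun x => σ x v) x0) :
    Tendsto (fun x => ∫⁻ v in I, ‖k (σ x v) - k (σ x0 v)‖ₑ) (𝓝 x0) (𝓝 0) := by
  rw [ENNReal.tendsto_nhds_zero]
  intro ε hε
  wlog hεt : ε ≠ ∞ generalizing ε with hw
  · exact (hw 1 one_pos (by simp)).mono (fun x hx => hx.trans (by push Not at hεt; rw [hεt]; simp))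
  have hC : ENNReal.ofReal C ≠ ∞ := by simp
  set K := ENNReal.ofReal C + 1 with hK
  have hK0 : K ≠ 0 := by simp [hK]
  have hKt : K ≠ ∞ := by simp [hK]
  have hη : ε / (4 * K) ≠ 0 := by
    simp only [ne_eq, ENNReal.div_eq_zero_iff, hε.ne', false_or]
    finiteness
  obtain ⟨g, hg, hgle, hgc, hgi⟩ := hk.exists_hasCompactSupport_lintegral_sub_le hη
  have hη' : K * (ε / (4 * K)) = ε / 4 := by
    rw [ENNReal.div_eq_inv_mul, ENNReal.div_eq_inv_mul, ENNReal.mul_inv (by simp) (by simp)]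
    rw [← mul_assoc, mul_comm 4⁻¹, ← mul_assoc, ENNReal.mul_inv_cancel hK0 hKt, one_mul]
  have hbound : ∀ x, (volume.restrict I).map (σ x) ≤ ENNReal.ofReal C • volume →
      ∫⁻ v in I, ‖k (σ x v) - g (σ x v)‖ₑ ≤ ε / 4 := by
    intro x hx
    have hmm : Measurable (fun u => ‖k u - g u‖ₑ) := (hkm.sub hgc.measurable).enorm
    calc ∫⁻ v in I, ‖k (σ x v) - g (σ x v)‖ₑ
        = ∫⁻ u, ‖k u - g u‖ₑ ∂((volume.restrict I).map (σ x)) := (lintegral_map hmm (hm x)).symm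
      _ ≤ ∫⁻ u, ‖k u - g u‖ₑ ∂(ENNReal.ofReal C • volume) := lintegral_mono' hx le_rfl
      _ = ENNReal.ofReal C * ∫⁻ u, ‖k u - g u‖ₑ := by rw [lintegral_smul_measure, smul_eq_mul]
      _ ≤ K * (ε / (4 * K)) := by
          gcongr
          exact le_self_add
      _ = _ := hη'
  obtain ⟨M, hM⟩ := hg.exists_bound_of_continuous hgc
  have hgt : Tendsto (fun x => ∫⁻ v in I, ‖g (σ x v) - g (σ x0 v)‖ₑ) (𝓝 x0) (𝓝 0) := by
    have : (0 : ℝ≥0∞) = ∫⁻ v in I, 0 := by simp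
    rw [this]
    apply tendsto_lintegral_filter_of_dominated_convergence (fun _ => ENNReal.ofReal (M + M))
    · filter_upwards with x
      exact ((hgc.measurable.comp (hm x)).sub (hgc.measurable.comp (hm x0))).enorm
    · filter_upwards with x
      filter_upwards with v
      rw [← ofReal_norm]
      exact ENNReal.ofReal_le_ofReal ((norm_sub_le _ _).trans (add_le_add (hM _) (hM _)))
    · rw [lintegral_const, Measure.restrict_apply_univ]
      finiteness
    · filter_upwards [hc] with v hv
      have h1 : ContinuousAt (fun x => ‖g (σ x v) - g (σ x0 v)‖ₑ) x0 := by
        apply ContinuousAt.enorm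
        exact ((hgc.continuousAt).comp hv).sub continuousAt_const
      have := h1.tendsto
      simpa using this
  rw [ENNReal.tendsto_nhds_zero] at hgt
  have h4 : (0 : ℝ≥0∞) < ε / 4 := by
    simp only [ENNReal.div_pos_iff, ne_eq, hε.ne', not_false_eq_true, true_and]; simp
  filter_upwards [hle, hgt (ε / 4) h4] with x hx1 hx2
  have m1' : Measurable (fun v => ‖k (σ x v) - g (σ x v)‖ₑ) :=
    ((hkm.comp (hm x)).sub (hgc.measurable.comp (hm x))).enorm
  have m2' : Measurable (fun v => ‖g (σ x v) - g (σ x0 v)‖ₑ) :=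
    ((hgc.measurable.comp (hm x)).sub (hgc.measurable.comp (hm x0))).enorm
  calc ∫⁻ v in I, ‖k (σ x v) - k (σ x0 v)‖ₑ
      ≤ ∫⁻ v in I, (‖k (σ x v) - g (σ x v)‖ₑ + ‖g (σ x v) - g (σ x0 v)‖ₑ
          + ‖k (σ x0 v) - g (σ x0 v)‖ₑ) := by
        apply lintegral_mono
        intro v
        have e : k (σ x v) - k (σ x0 v) = (k (σ x v) - g (σ x v)) + (g (σ x v) - g (σ x0 v))
          - (k (σ x0 v) - g (σ x0 v)) := by ring
        beta_reduce
        rw [e]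
        exact (enorm_sub_le).trans (add_le_add_left (enorm_add_le _ _) _)
    _ = (∫⁻ v in I, ‖k (σ x v) - g (σ x v)‖ₑ) + (∫⁻ v in I, ‖g (σ x v) - g (σ x0 v)‖ₑ)
          + ∫⁻ v in I, ‖k (σ x0 v) - g (σ x0 v)‖ₑ := by
        have m12 : Measurable (fun v => ‖k (σ x v) - g (σ x v)‖ₑ + ‖g (σ x v) - g (σ x0 v)‖ₑ) :=
          m1'.add m2'
        rw [lintegral_add_left m12, lintegral_add_left m1']
    _ ≤ ε / 4 + ε / 4 + ε / 4 := by
        gcongr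
        · exact hbound x hx1
        · exact hbound x0 hle.self_of_nhds
    _ ≤ ε / 4 + ε / 4 + ε / 4 + ε / 4 := le_self_add
    _ = ε := by
        rw [← ENNReal.add_halves ε]
        have : ε / 4 + ε / 4 = ε / 2 := by
          have h := ENNReal.add_halves (ε / 2)
          have h2 : ε / 2 / 2 = ε / 4 := by
            rw [ENNReal.div_eq_inv_mul, ENNReal.div_eq_inv_mul, ENNReal.div_eq_inv_mul, ← mul_assoc,
              ← ENNReal.mul_inv (by simp) (by simp)]
            norm_num
          rwa [h2] at h
        rw [add_assoc]
        simp only [this, ENNReal.add_halves]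

/-- derivative of `ellMap` in the line parameter -/
def sig' (γ x v : ℝ) : ℝ :=
  -Real.cos γ - x * (v * Real.sin γ ^ 2 / Real.sqrt (1 - v ^ 2 * Real.sin γ ^ 2))

lemma root_deriv {γ v : ℝ} (h : v ∈ Vs γ) :
    HasDerivAt (fun v => Real.sqrt (1 - v ^ 2 * Real.sin γ ^ 2))
      (-(v * Real.sin γ ^ 2 / Real.sqrt (1 - v ^ 2 * Real.sin γ ^ 2))) v := by
  have hp := Vs_pos h
  have h1 : HasDerivAt (fun v : ℝ => 1 - v ^ 2 * Real.sin γ ^ 2) (-(2 * v * Real.sin γ ^ 2)) v := by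
    have := ((hasDerivAt_pow 2 v).mul_const (Real.sin γ ^ 2)).const_sub 1
    simpa using this
  have h2 := h1.sqrt (Real.sqrt_pos.1 hp).ne'
  convert h2 using 1
  field_simp

lemma ellMap_deriv {γ x v : ℝ} (h : v ∈ Vs γ) :
    HasDerivAt (fun v => ellMap γ v x) (sig' γ x v) v := by
  have h1 := ((hasDerivAt_id v).neg.mul_const (Real.cos γ)).add ((root_deriv h).const_mul x)
  have e : sig' γ x v = -1 * Real.cos γ + x * -(v * Real.sin γ ^ 2 / √(1 - v ^ 2 * Real.sin γ ^ 2)) := by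
    unfold sig'; ring
  rw [e]
  exact h1

lemma sigma_mem {γ x v : ℝ} (h : v ∈ Vs γ) (hx : x ∈ Ioo (-1 : ℝ) 1) : ellMap γ v x ∈ Vs γ := by
  have h1 := (ell_mem h).2 hx
  have h2 : (v, ellMap γ v x) ∈ Eset γ := Eset_swap.1 h1
  exact Eset_snd h2

lemma tau_deriv {γ x v : ℝ} (h : v ∈ Vs γ) (hx : x ∈ Ioo (-1 : ℝ) 1) (hs : Real.sin γ ≠ 0) :
    ∃ D ≠ 0, HasDerivAt (fun v => ellInv γ (ellMap γ v x) v) D v := by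
  have hw := sigma_mem h hx
  have hp := Vs_pos h
  have hwp := Vs_pos hw
  have d1 := ellMap_deriv (x := x) h
  have d2 := (root_deriv hw).comp v d1
  have d3 := ((hasDerivAt_id v).add (d1.mul_const (Real.cos γ))).div d2 hwp.ne'
  refine ⟨_, ?_, d3⟩
  simp only [Function.comp]
  have hr2 : Real.sqrt (1 - v ^ 2 * Real.sin γ ^ 2) ^ 2 = 1 - v ^ 2 * Real.sin γ ^ 2 :=
    Real.sq_sqrt (Real.sqrt_pos.1 hp).le
  have hw2 : Real.sqrt (1 - ellMap γ v x ^ 2 * Real.sin γ ^ 2) ^ 2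
      = 1 - ellMap γ v x ^ 2 * Real.sin γ ^ 2 :=
    Real.sq_sqrt (Real.sqrt_pos.1 hwp).le
  have hσ : ellMap γ v x = -v * Real.cos γ + x * Real.sqrt (1 - v ^ 2 * Real.sin γ ^ 2) := rfl
  have hσ' : sig' γ x v * Real.sqrt (1 - v ^ 2 * Real.sin γ ^ 2)
      = -Real.cos γ * Real.sqrt (1 - v ^ 2 * Real.sin γ ^ 2) - x * (v * Real.sin γ ^ 2) := by
    unfold sig'; field_simp
  have hsc := Real.sin_sq_add_cos_sq γ
  set s := Real.sin γ
  set c := Real.cos γ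
  set w := Real.sqrt (1 - ellMap γ v x ^ 2 * s ^ 2)
  set r := Real.sqrt (1 - v ^ 2 * s ^ 2)
  set σ := ellMap γ v x
  set σ' := sig' γ x v
  have key : ((1 + σ' * c) * w ^ 2 + (v + σ * c) * (σ * s ^ 2) * σ') = s ^ 2 * (1 - x ^ 2) := by
    have e1 : (1 + σ' * c) * w ^ 2 + (v + σ * c) * (σ * s ^ 2) * σ'
        = 1 - s ^ 2 * σ ^ 2 + σ' * (c + s ^ 2 * v * σ) := by rw [hw2]; ring
    have e2 : c + s ^ 2 * v * σ = r * (r * c + s ^ 2 * v * x) := by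
      rw [hσ]
      have : r * (r * c + s ^ 2 * v * x) = r ^ 2 * c + s ^ 2 * v * x * r := by ring
      rw [this, hr2]; ring
    have e3 : σ' * (r * (r * c + s ^ 2 * v * x)) = - (r * c + s ^ 2 * v * x) ^ 2 := by
      rw [← mul_assoc, hσ']; ring
    have e4 : σ ^ 2 = v ^ 2 * c ^ 2 - 2 * v * c * x * r + x ^ 2 * r ^ 2 := by rw [hσ]; ring
    have e5 : (r * c + s ^ 2 * v * x) ^ 2 = r ^ 2 * c ^ 2 + 2 * r * c * s ^ 2 * v * x + s ^ 4 * v ^ 2 * x ^ 2 := by ring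
    rw [e1, e2, e3, e4, e5, hr2]
    linear_combination -hsc
  have hpos : 0 < s ^ 2 * (1 - x ^ 2) := by
    have : 0 < s ^ 2 := by positivity
    have : x ^ 2 < 1 := by rw [sq_lt_one_iff_abs_lt_one, abs_lt]; exact hx
    apply mul_pos <;> linarith
  rw [div_ne_zero_iff]
  refine ⟨?_, by positivity⟩
  intro h0
  have : ((1 + σ' * c) * w - (v + σ * c) * (-(σ * s ^ 2 / w) * σ')) * w = 0 := by
    simp only [Pi.add_apply] at h0
    rw [show (1 + σ' * c) * w - (v + σ * c) * (-(σ * s ^ 2 / w) * σ') = 0 from h0, zero_mul]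
  have e : ((1 + σ' * c) * w - (v + σ * c) * (-(σ * s ^ 2 / w) * σ')) * w
     = ((1 + σ' * c) * w ^ 2 + (v + σ * c) * (σ * s ^ 2) * σ') := by field_simp; ring
  rw [e, key] at this
  linarith

lemma crit_null {γ x : ℝ} (hs : Real.sin γ ≠ 0) (hc : Real.cos γ ≠ 0) :
    volume {v | v ∈ Vs γ ∧ sig' γ x v = 0} = 0 := by
  set s := Real.sin γ
  set c := Real.cos γ
  have hK : 0 < x ^ 2 * s ^ 4 + c ^ 2 * s ^ 2 := by positivity
  apply Set.Finite.measure_zero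
  apply Set.Finite.subset (s := {Real.sqrt (c ^ 2 / (x ^ 2 * s ^ 4 + c ^ 2 * s ^ 2)),
    -Real.sqrt (c ^ 2 / (x ^ 2 * s ^ 4 + c ^ 2 * s ^ 2))}) (by simp)
  rintro v ⟨hv, h0⟩
  have hp := Vs_pos hv
  have hr2 : Real.sqrt (1 - v ^ 2 * s ^ 2) ^ 2 = 1 - v ^ 2 * s ^ 2 :=
    Real.sq_sqrt (Real.sqrt_pos.1 hp).le
  have h1 : c * Real.sqrt (1 - v ^ 2 * s ^ 2) = - (x * v * s ^ 2) := by
    unfold sig' at h0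
    field_simp at h0
    change - (c * √(1 - v ^ 2 * s ^ 2)) - x * v * s ^ 2 = √(1 - v ^ 2 * s ^ 2) * 0 at h0
    linarith
  have h2 : c ^ 2 * (1 - v ^ 2 * s ^ 2) = (x * v * s ^ 2) ^ 2 := by
    rw [← hr2, ← mul_pow, h1]; ring
  have h3 : v ^ 2 = c ^ 2 / (x ^ 2 * s ^ 4 + c ^ 2 * s ^ 2) := by
    rw [eq_div_iff hK.ne']; linarith
  rw [← h3, Real.sqrt_sq_eq_abs]
  rcases abs_choice v with h | h <;> simp [h]

lemma pick {γ x0 : ℝ} {b : ℝ → ℝ} (hs : Real.sin γ ≠ 0) (hc : Real.cos γ ≠ 0)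
    (hnb : ¬ ∀ᵐ v, v ∈ Vs γ → b v = 0) :
    ∃ v0 ∈ Vs γ, sig' γ x0 v0 ≠ 0 ∧ ∀ ε > 0, volume ({v | b v ≠ 0} ∩ Metric.ball v0 ε) ≠ 0 := by
  have h1 : volume {v | v ∈ Vs γ ∧ b v ≠ 0 ∧ sig' γ x0 v ≠ 0} ≠ 0 := by
    intro h0
    apply hnb
    rw [ae_iff]
    refine measure_mono_null ?_ (measure_union_null h0 (crit_null (x := x0) hs hc))
    intro v hv
    simp only [mem_ofPred_eq, Classical.not_imp] at hv
    by_cases hz : sig' γ x0 v = 0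
    · exact Or.inr ⟨hv.1, hz⟩
    · exact Or.inl ⟨hv.1, hv.2, hz⟩
  obtain ⟨v0, hv0, h2⟩ := exists_mem_forall_mem_nhdsWithin_pos_measure h1
  refine ⟨v0, hv0.1, hv0.2.2, fun ε hε => ?_⟩
  have := h2 (_ ∩ Metric.ball v0 ε) (Filter.inter_mem self_mem_nhdsWithin
    (mem_nhdsWithin_of_mem_nhds (Metric.ball_mem_nhds v0 hε)))
  refine (lt_of_lt_of_le this (measure_mono ?_)).ne'
  rintro v ⟨hv, hv'⟩
  exact ⟨hv.2.1, hv'⟩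

lemma sigma_cd {γ x0 v0 : ℝ} (h : v0 ∈ Vs γ) :
    ContDiffAt ℝ 1 (fun p : ℝ × ℝ => ellMap γ p.2 p.1) (x0, v0) := by
  have hp := Real.sqrt_pos.1 (Vs_pos h)
  unfold ellMap
  apply ContDiffAt.add (by fun_prop)
  apply ContDiffAt.mul (by fun_prop)
  exact ContDiffAt.sqrt (by fun_prop) hp.ne'

lemma tau_cd {γ x0 v0 : ℝ} (h : v0 ∈ Vs γ) (hx : x0 ∈ Ioo (-1 : ℝ) 1) :
    ContDiffAt ℝ 1 (fun p : ℝ × ℝ => ellInv γ (ellMap γ p.2 p.1) p.2) (x0, v0) := by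
  have hp := Real.sqrt_pos.1 (Vs_pos (sigma_mem h hx))
  have h1 := sigma_cd (x0 := x0) h
  unfold ellInv
  apply ContDiffAt.div (by fun_prop)
  · exact ContDiffAt.sqrt (by fun_prop) hp.ne'
  · exact (Vs_pos (sigma_mem h hx)).ne'

lemma sig_meas (γ : ℝ) : Measurable (fun p : ℝ × ℝ => ellMap γ p.2 p.1) := by
  unfold ellMap; fun_prop

lemma tau_meas (γ : ℝ) : Measurable (fun p : ℝ × ℝ => ellInv γ (ellMap γ p.2 p.1) p.2) := by
  unfold ellInv ellMap; fun_prop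

lemma local_data {γ x0 v0 : ℝ} (hs : Real.sin γ ≠ 0) (h : v0 ∈ Vs γ) (hx : x0 ∈ Ioo (-1 : ℝ) 1)
    (h' : sig' γ x0 v0 ≠ 0) :
    ∃ ε > 0, ∃ C : ℝ, Metric.ball v0 ε ⊆ Vs γ ∧ Metric.ball x0 ε ⊆ Ioo (-1 : ℝ) 1 ∧
      ∀ x ∈ Metric.ball x0 ε,
        (volume.restrict (Metric.ball v0 ε)).map (fun v => ellMap γ v x) ≤ ENNReal.ofReal C • volume ∧
        (volume.restrict (Metric.ball v0 ε)).map (fun v => ellInv γ (ellMap γ v x) v)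
          ≤ ENNReal.ofReal C • volume := by
  obtain ⟨ε1, hε1, hb1⟩ := Metric.isOpen_iff.1 (Vs_open γ) v0 h
  obtain ⟨ε2, hε2, hb2⟩ := Metric.isOpen_iff.1 (isOpen_Ioo (a := (-1 : ℝ)) (b := 1)) x0 hx
  obtain ⟨D, hD0, hD⟩ := tau_deriv h hx hs
  obtain ⟨ε3, hε3, κ1, hκ1, hl1⟩ := antilip (sigma_cd (x0 := x0) h) (ellMap_deriv h) h'
  obtain ⟨ε4, hε4, κ2, hκ2, hl2⟩ := antilip (tau_cd h hx) hD hD0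
  refine ⟨min (min ε1 ε2) (min ε3 ε4), by positivity, max κ1⁻¹ κ2⁻¹, ?_, ?_, ?_⟩
  · exact (Metric.ball_subset_ball (by simp)).trans hb1
  · exact (Metric.ball_subset_ball (by simp)).trans hb2
  intro x hx
  have s3 : ∀ z : ℝ, Metric.ball z (min (min ε1 ε2) (min ε3 ε4)) ⊆ Metric.ball z ε3 :=
    fun z => Metric.ball_subset_ball (by simp)
  have s4 : ∀ z : ℝ, Metric.ball z (min (min ε1 ε2) (min ε3 ε4)) ⊆ Metric.ball z ε4 :=
    fun z => Metric.ball_subset_ball (by simp)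
  have mono : ∀ a b : ℝ, a ≤ b → ENNReal.ofReal a • (volume : Measure ℝ) ≤ ENNReal.ofReal b • volume := by
    intro a b hab
    rw [Measure.le_iff]
    intro N _
    simp only [Measure.smul_apply, smul_eq_mul]
    gcongr
  constructor
  · refine (map_le ((sig_meas γ).comp (measurable_prodMk_left (x := x))) Metric.isOpen_ball.measurableSet hκ1 ?_).trans (mono _ _ (le_max_left _ _))
    intro v hv v' hv'
    exact hl1 x (s3 _ hx) v (s3 _ hv) v' (s3 _ hv')
  · refine (map_le ((tau_meas γ).comp (measurable_prodMk_left (x := x))) Metric.isOpen_ball.measurableSet hκ2 ?_).trans (mono _ _ (le_max_right _ _))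
    intro v hv v' hv'
    exact hl2 x (s4 _ hx) v (s4 _ hv) v' (s4 _ hv')

open Filter Topology in
lemma loc_const {γ : ℝ} (hs : Real.sin γ ≠ 0) (hc : Real.cos γ ≠ 0) {a b c d φ1 φ2 : ℝ → ℝ}
    (ma : Measurable a) (mb : Measurable b) (mc : Measurable c) (md : Measurable d)
    (mφ1 : Measurable φ1) (mφ2 : Measurable φ2)
    (ba : ∀ v, |a v| ≤ 1) (bb : ∀ v, |b v| ≤ 1) (bc : ∀ v, |c v| ≤ 1) (bd : ∀ v, |d v| ≤ 1)
    (bφ2 : ∀ v, |φ2 v| ≤ 1) (ic : Integrable c) (idd : Integrable d) (i2 : Integrable φ2)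
    (h1 : ∀ x, φ1 x = 1 ∨ φ1 x = -1)
    (hid : ∀ᵐ p ∂volume.restrict (Eset γ), a p.2 + b p.2 * φ1 (ellInv γ p.2 p.1)
      = c p.1 + d p.1 * φ2 (ellInv γ p.1 p.2))
    (hnb : ¬ ∀ᵐ v, v ∈ Vs γ → b v = 0) {x0 : ℝ} (hx0 : x0 ∈ Ioo (-1 : ℝ) 1) :
    ∃ U, IsOpen U ∧ x0 ∈ U ∧ ((∀ᵐ x ∂volume.restrict U, φ1 x = 1) ∨
      (∀ᵐ x ∂volume.restrict U, φ1 x = -1)) := by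
  obtain ⟨v0, hv0, hv0', hpos⟩ := pick (x0 := x0) hs hc hnb
  obtain ⟨ε, hε, C, hIV, hxI, hle⟩ := local_data hs hv0 hx0 hv0'
  set I := Metric.ball v0 ε with hI
  have hIm : MeasurableSet I := Metric.isOpen_ball.measurableSet
  have hIf : volume I ≠ ∞ := measure_ball_lt_top.ne
  have : IsFiniteMeasure (volume.restrict I) := ⟨by rw [Measure.restrict_apply_univ]; exact hIf.lt_top⟩
  set σ : ℝ → ℝ → ℝ := fun x v => ellMap γ v x with hσ
  set τ : ℝ → ℝ → ℝ := fun x v => ellInv γ (ellMap γ v x) v with hτ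
  have mσ : ∀ x, Measurable (σ x) := fun x => (sig_meas γ).comp (measurable_prodMk_left (x := x))
  have mτ : ∀ x, Measurable (τ x) := fun x => (tau_meas γ).comp (measurable_prodMk_left (x := x))
  have hball : ∀ᶠ x in 𝓝 x0, x ∈ Metric.ball x0 ε := Metric.ball_mem_nhds x0 hε
  have cσ : ∀ᵐ v ∂volume.restrict I, ContinuousAt (fun x => σ x v) x0 := by
    rw [ae_restrict_iff' hIm]
    filter_upwards with v hv
    have := (sigma_cd (x0 := x0) (hIV hv)).continuousAt
    exact ContinuousAt.comp (f := fun x : ℝ => (x, v)) this (by fun_prop)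
  have cτ : ∀ᵐ v ∂volume.restrict I, ContinuousAt (fun x => τ x v) x0 := by
    rw [ae_restrict_iff' hIm]
    filter_upwards with v hv
    have := (tau_cd (x0 := x0) (hIV hv) hx0).continuousAt
    exact ContinuousAt.comp (f := fun x : ℝ => (x, v)) this (by fun_prop)
  have Lc := L1_cont ic mc hIf mσ (hball.mono fun x hx => (hle x hx).1) cσ
  have Ld := L1_cont idd md hIf mσ (hball.mono fun x hx => (hle x hx).1) cσ
  have L2 := L1_cont i2 mφ2 hIf mτ (hball.mono fun x hx => (hle x hx).2) cτ
  set R : ℝ → ℝ → ℝ := fun x v => b v * (c (σ x v) + d (σ x v) * φ2 (τ x v) - a v) with hR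
  have mR : ∀ x, Measurable (R x) := fun x => mb.mul (((mc.comp (mσ x)).add
    ((md.comp (mσ x)).mul (mφ2.comp (mτ x)))).sub ma)
  have iR : ∀ x, Integrable (R x) (volume.restrict I) := by
    intro x
    apply Integrable.of_bound (C := 3) (mR x).aestronglyMeasurable
    filter_upwards with v
    rw [Real.norm_eq_abs, hR]
    simp only [abs_mul]
    have e1 : |d (σ x v) * φ2 (τ x v)| ≤ 1 := by
      rw [abs_mul]; exact mul_le_one₀ (bd _) (abs_nonneg _) (bφ2 _)
    have e2 : |c (σ x v) + d (σ x v) * φ2 (τ x v) - a v| ≤ 3 := by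
      have := abs_sub (c (σ x v) + d (σ x v) * φ2 (τ x v)) (a v)
      have := abs_add_le (c (σ x v)) (d (σ x v) * φ2 (τ x v))
      linarith [ba v, bc (σ x v)]
    calc _ ≤ 1 * 3 := mul_le_mul (bb v) e2 (abs_nonneg _) zero_le_one
      _ = 3 := by norm_num
  set J : ℝ → ℝ := fun x => ∫ v in I, R x v with hJ
  have Jc : Tendsto J (𝓝 x0) (𝓝 (J x0)) := by
    apply tendsto_integral_of_L1 _ (mR x0).aestronglyMeasurable (.of_forall iR)
    have hsum := (Lc.add Ld).add L2
    simp only [add_zero] at hsum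
    refine tendsto_of_tendsto_of_tendsto_of_le_of_le tendsto_const_nhds hsum
      (fun _ => zero_le) ?_
    intro x
    have n1 : Measurable (fun v => ‖c (σ x v) - c (σ x0 v)‖ₑ) :=
      ((mc.comp (mσ x)).sub (mc.comp (mσ x0))).enorm
    have n2 : Measurable (fun v => ‖d (σ x v) - d (σ x0 v)‖ₑ) :=
      ((md.comp (mσ x)).sub (md.comp (mσ x0))).enorm
    have n12 : Measurable (fun v => ‖c (σ x v) - c (σ x0 v)‖ₑ + ‖d (σ x v) - d (σ x0 v)‖ₑ) :=
      n1.add n2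
    beta_reduce
    rw [← lintegral_add_left n1, ← lintegral_add_left n12]
    apply lintegral_mono
    intro v
    beta_reduce
    simp only [← ofReal_norm]
    rw [← ENNReal.ofReal_add (norm_nonneg _) (norm_nonneg _),
      ← ENNReal.ofReal_add (by positivity) (norm_nonneg _)]
    apply ENNReal.ofReal_le_ofReal
    simp only [Real.norm_eq_abs]
    have e : R x v - R x0 v = b v * ((c (σ x v) - c (σ x0 v)) + (d (σ x v) - d (σ x0 v)) * φ2 (τ x v)
      + d (σ x0 v) * (φ2 (τ x v) - φ2 (τ x0 v))) := by simp only [hR]; ring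
    rw [e, abs_mul]
    refine (mul_le_of_le_one_left (abs_nonneg _) (bb v)).trans ?_
    refine (abs_add_three _ _ _).trans ?_
    rw [abs_mul, abs_mul]
    gcongr
    · exact mul_le_of_le_one_right (abs_nonneg _) (bφ2 _)
    · exact mul_le_of_le_one_left (abs_nonneg _) (bd _)
  set B := ∫ v in I, b v ^ 2 with hB
  have ib2 : Integrable (fun v => b v ^ 2) (volume.restrict I) := by
    apply Integrable.of_bound (C := 1) (mb.pow_const 2).aestronglyMeasurable
    filter_upwards with v
    rw [Real.norm_eq_abs, abs_pow]
    exact pow_le_one₀ (abs_nonneg _) (bb v)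
  have hBpos : 0 < B := by
    rw [hB, integral_pos_iff_support_of_nonneg (fun v => sq_nonneg _) ib2,
      Measure.restrict_apply' hIm]
    have e : Function.support (fun v => b v ^ 2) = {v | b v ≠ 0} := by
      ext v; simp
    rw [e]
    exact pos_iff_ne_zero.2 (hpos ε hε)
  have hJB : ∀ᵐ x ∂m1, J x = φ1 x * B := by
    have q1 : ∀ᵐ v ∂volume.restrict I, ∀ᵐ x ∂m1,
        a v + b v * φ1 x = c (σ x v) + d (σ x v) * φ2 (τ x v) := by
      rw [ae_restrict_iff' hIm]
      filter_upwards [ae_lines hid] with v hv hvI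
      filter_upwards [hv (hIV hvI)] with x hx
      simp only [ellInv_ellMap (hIV hvI)] at hx
      exact hx
    rw [Measure.ae_ae_comm] at q1
    · filter_upwards [q1] with x hx
      simp only [hJ, hB]
      rw [← integral_const_mul]
      apply integral_congr_ae
      filter_upwards [hx] with v hv
      simp only [hR]
      rw [← hv]; ring
    · apply measurableSet_eq_fun
      · exact (ma.comp measurable_fst).add ((mb.comp measurable_fst).mul (mφ1.comp measurable_snd))
      · have k1 : Measurable (fun p : ℝ × ℝ => σ p.2 p.1) := (sig_meas γ).comp measurable_swap
        have k2 : Measurable (fun p : ℝ × ℝ => τ p.2 p.1) := (tau_meas γ).comp measurable_swap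
        exact (mc.comp k1).add ((md.comp k1).mul (mφ2.comp k2))
  have hev : ∀ᶠ x in 𝓝 x0, |J x - J x0| < B / 2 := by
    have := Metric.tendsto_nhds.1 Jc (B / 2) (by positivity)
    simpa [Real.dist_eq] using this
  obtain ⟨U, hU, hUo, hxU⟩ := eventually_nhds_iff.1 (hev.and (isOpen_Ioo.mem_nhds hx0))
  refine ⟨U, hUo, hxU, ?_⟩
  have hJU : ∀ᵐ x ∂volume.restrict U, J x = φ1 x * B := by
    unfold m1 at hJB
    rw [Measure.ae_ennreal_smul_measure_iff (by simp)] at hJB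
    exact ae_mono (Measure.restrict_mono (fun x hx => (hU x hx).2) le_rfl) hJB
  rcases le_or_gt 0 (J x0) with hj | hj
  · left
    rw [ae_restrict_iff' hUo.measurableSet] at hJU ⊢
    filter_upwards [hJU] with x hx hxU
    have e := hx hxU
    have := (hU x hxU).1
    rw [abs_lt] at this
    rcases h1 x with h | h
    · exact h
    · rw [h] at e; linarith [this.1]
  · right
    rw [ae_restrict_iff' hUo.measurableSet] at hJU ⊢
    filter_upwards [hJU] with x hx hxU
    have e := hx hxU
    have := (hU x hxU).1
    rw [abs_lt] at this
    rcases h1 x with h | h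
    · rw [h] at e; linarith [this.2]
    · exact h

open Topology in
lemma conn_ae {X : Type*} [TopologicalSpace X] [SecondCountableTopology X] [MeasurableSpace X]
    (μ : Measure X) [μ.IsOpenPosMeasure] {S W : Set X} (hW : IsPreconnected W)
    (h : ∀ x ∈ W, ∃ U, IsOpen U ∧ x ∈ U ∧ (μ (U ∩ S) = 0 ∨ μ (U \ S) = 0)) :
    μ (W ∩ S) = 0 ∨ μ (W \ S) = 0 := by
  set A := ⋃₀ {U : Set X | IsOpen U ∧ μ (U ∩ S) = 0} with hA
  set B := ⋃₀ {U : Set X | IsOpen U ∧ μ (U \ S) = 0} with hB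
  have oA : IsOpen A := isOpen_sUnion fun U hU => hU.1
  have oB : IsOpen B := isOpen_sUnion fun U hU => hU.1
  have hWAB : W ⊆ A ∪ B := by
    intro x hx
    obtain ⟨U, hU, hxU, h1 | h1⟩ := h x hx
    · exact Or.inl ⟨U, ⟨hU, h1⟩, hxU⟩
    · exact Or.inr ⟨U, ⟨hU, h1⟩, hxU⟩
  have nA : μ (A ∩ S) = 0 := by
    apply measure_null_of_locally_null
    rintro x ⟨⟨U, ⟨hU, h1⟩, hxU⟩, hxS⟩
    refine ⟨U ∩ (A ∩ S), Filter.inter_mem (mem_nhdsWithin_of_mem_nhds (hU.mem_nhds hxU))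
      self_mem_nhdsWithin, measure_mono_null ?_ h1⟩
    rintro y ⟨h2, h3, h4⟩; exact ⟨h2, h4⟩
  have nB : μ (B \ S) = 0 := by
    apply measure_null_of_locally_null
    rintro x ⟨⟨U, ⟨hU, h1⟩, hxU⟩, hxS⟩
    refine ⟨U ∩ (B \ S), Filter.inter_mem (mem_nhdsWithin_of_mem_nhds (hU.mem_nhds hxU))
      self_mem_nhdsWithin, measure_mono_null ?_ h1⟩
    rintro y ⟨h2, h3, h4⟩; exact ⟨h2, h4⟩
  by_cases h1 : (W ∩ A).Nonempty
  · by_cases h2 : (W ∩ B).Nonempty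
    · obtain ⟨x, hx, hxA, hxB⟩ := hW A B oA oB hWAB h1 h2
      exfalso
      have h3 : μ (A ∩ B) = 0 := by
        refine measure_mono_null ?_ (measure_union_null nA nB)
        rintro y ⟨y1, y2⟩
        by_cases hy : y ∈ S
        · exact Or.inl ⟨y1, hy⟩
        · exact Or.inr ⟨y2, hy⟩
      exact (oA.inter oB).measure_ne_zero μ ⟨x, hxA, hxB⟩ h3
    · left
      refine measure_mono_null ?_ nA
      rintro y ⟨y1, y2⟩
      refine ⟨(hWAB y1).resolve_right fun h => h2 ⟨y, y1, h⟩, y2⟩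
  · right
    refine measure_mono_null ?_ nB
    rintro y ⟨y1, y2⟩
    refine ⟨(hWAB y1).resolve_left fun h => h1 ⟨y, y1, h⟩, y2⟩

lemma Vs_fin {γ : ℝ} (hs : Real.sin γ ≠ 0) : volume (Vs γ) ≠ ∞ := by
  have h : Vs γ ⊆ Icc (-(1 / |Real.sin γ|)) (1 / |Real.sin γ|) := by
    intro v hv
    simp only [Vs, mem_ofPred_eq] at hv
    rw [← mul_pow, sq_lt_one_iff_abs_lt_one, abs_mul] at hv
    rw [mem_Icc, ← abs_le, le_div_iff₀ (abs_pos.2 hs)]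
    exact hv.le
  exact ((measure_mono h).trans_lt measure_Icc_lt_top).ne

lemma E_fin {γ : ℝ} (hs : Real.sin γ ≠ 0) : volume (Eset γ) ≠ ∞ := by
  have h : Eset γ ⊆ Vs γ ×ˢ Vs γ := by
    rintro ⟨u, v⟩ h
    refine ⟨Eset_snd (u := v) (Eset_swap.1 h), Eset_snd h⟩
  refine ((measure_mono h).trans_lt ?_).ne
  rw [Measure.volume_eq_prod, Measure.prod_prod]
  exact ENNReal.mul_lt_top (Vs_fin hs).lt_top (Vs_fin hs).lt_top

lemma b_zero {γ : ℝ} (hs : Real.sin γ ≠ 0) (hc : Real.cos γ ≠ 0) {a b c d : ℝ → ℝ} {H1 H2 : Set ℝ}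
    (ma : Measurable a) (mb : Measurable b) (mc : Measurable c) (md : Measurable d)
    (mH1 : MeasurableSet H1) (mH2 : MeasurableSet H2) (hH1 : m1 H1 = m1 H1ᶜ)
    (ba : ∀ v, |a v| ≤ 1) (bb : ∀ v, |b v| ≤ 1) (bc : ∀ v, |c v| ≤ 1) (bd : ∀ v, |d v| ≤ 1)
    (hid : ∀ᵐ p ∂volume.restrict (Eset γ), a p.2 + b p.2 * sg H1 (ellInv γ p.2 p.1)
      = c p.1 + d p.1 * sg H2 (ellInv γ p.1 p.2)) :
    ∀ᵐ v, v ∈ Vs γ → b v = 0 := by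
  by_contra hnb
  have mV := (Vs_open γ).measurableSet
  have key : ∀ (A : Set ℝ) (hA : MeasurableSet A) (hAf : volume A ≠ ∞) (f : ℝ → ℝ)
      (mf : Measurable f) (bf : ∀ v, |f v| ≤ 1), Integrable (A.indicator f) := by
    intro A hA hAf f mf bf
    rw [integrable_indicator_iff hA]
    have : IsFiniteMeasure (volume.restrict A) :=
      ⟨by rw [Measure.restrict_apply_univ]; exact hAf.lt_top⟩
    exact Integrable.of_bound (C := 1) mf.aestronglyMeasurable (.of_forall bf)
  have kb : ∀ (A : Set ℝ) (f : ℝ → ℝ) (bf : ∀ v, |f v| ≤ 1) v, |A.indicator f v| ≤ 1 := by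
    intro A f bf v
    by_cases h : v ∈ A
    · rw [indicator_of_mem h]; exact bf v
    · rw [indicator_of_notMem h]; simp
  have hid' : ∀ᵐ p ∂volume.restrict (Eset γ), a p.2 + b p.2 * sg H1 (ellInv γ p.2 p.1)
      = (Vs γ).indicator c p.1 + (Vs γ).indicator d p.1 *
        (Ioo (-1 : ℝ) 1).indicator (sg H2) (ellInv γ p.1 p.2) := by
    rw [ae_restrict_iff' (Eset_open γ).measurableSet] at hid ⊢
    filter_upwards [hid] with p hp hpE
    have hpE' : (p.2, p.1) ∈ Eset γ := Eset_swap.2 hpE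
    have hu : p.1 ∈ Vs γ := Eset_snd hpE'
    have hx : ellInv γ p.1 p.2 ∈ Ioo (-1 : ℝ) 1 := by
      rw [← ell_mem hu, ellMap_ellInv hu]; exact hpE'
    rw [indicator_of_mem hu, indicator_of_mem hu, indicator_of_mem hx]
    exact hp hpE
  have hloc : ∀ x ∈ Ioo (-1 : ℝ) 1, ∃ U, IsOpen U ∧ x ∈ U ∧
      (volume (U ∩ H1) = 0 ∨ volume (U \ H1) = 0) := by
    intro x hx
    obtain ⟨U, hU, hxU, h⟩ := loc_const hs hc ma mb (mc.indicator mV) (md.indicator mV) (sg_meas mH1)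
      ((sg_meas mH2).indicator measurableSet_Ioo) ba bb (kb _ _ bc) (kb _ _ bd) (kb _ _ (sg_abs H2))
      (key _ mV (Vs_fin hs) _ mc bc) (key _ mV (Vs_fin hs) _ md bd)
      (key _ measurableSet_Ioo (by simp) _ (sg_meas mH2) (sg_abs H2)) (sg_cases H1) hid' hnb hx
    refine ⟨U, hU, hxU, ?_⟩
    rw [ae_restrict_iff' hU.measurableSet, ae_restrict_iff' hU.measurableSet, ae_iff, ae_iff] at h
    rcases h with h | h
    · right
      refine measure_mono_null ?_ h
      rintro y ⟨y1, y2⟩ hy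
      have := hy y1
      rw [sg_notMem y2] at this; norm_num at this
    · left
      refine measure_mono_null ?_ h
      rintro y ⟨y1, y2⟩ hy
      have := hy y1
      rw [sg_mem y2] at this; norm_num at this
  have hp : m1 H1 + m1 H1ᶜ = 1 := prob_add_prob_compl mH1
  have em : ∀ A, MeasurableSet A → volume (Ioo (-1 : ℝ) 1 ∩ A) = 0 → m1 A = 0 := by
    intro A hA h
    unfold m1
    rw [Measure.smul_apply, Measure.restrict_apply hA, inter_comm, h, smul_zero]
  rcases conn_ae volume isPreconnected_Ioo hloc with h | h
  · have := em _ mH1 h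
    rw [← hH1, this] at hp; simp at hp
  · have := em _ mH1.compl (by rwa [← sdiff_eq])
    rw [hH1, this] at hp; simp at hp

lemma E_preconn (γ : ℝ) : IsPreconnected (Eset γ) := by
  apply Convex.isPreconnected
  rintro ⟨u, v⟩ h ⟨u', v'⟩ h' α β hα hβ hαβ
  simp only [Eset, mem_ofPred_eq] at h h' ⊢
  simp only [Prod.smul_mk, Prod.mk_add_mk, smul_eq_mul]
  rw [quad_eq] at h h' ⊢
  set X := u + v * Real.cos γ
  set X' := u' + v' * Real.cos γ
  have e1 : (α * u + β * u' + (α * v + β * v') * Real.cos γ) = α * X + β * X' := by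
    simp only [X, X']; ring
  rw [e1]
  have hβ' : β = 1 - α := by linarith
  subst hβ'
  have i1 : (α * X + (1 - α) * X') ^ 2 ≤ α * X ^ 2 + (1 - α) * X' ^ 2 := by
    nlinarith [mul_nonneg (mul_nonneg hα hβ) (sq_nonneg (X - X'))]
  have i2 : (α * v + (1 - α) * v') ^ 2 ≤ α * v ^ 2 + (1 - α) * v' ^ 2 := by
    nlinarith [mul_nonneg (mul_nonneg hα hβ) (sq_nonneg (v - v'))]
  have i3 := mul_le_mul_of_nonneg_right i2 (sq_nonneg (Real.sin γ))
  rcases hα.eq_or_lt with h0 | h0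
  · subst h0; nlinarith
  · nlinarith [mul_lt_mul_of_pos_left h h0, mul_le_mul_of_nonneg_left h'.le hβ]

open Filter Topology in
lemma const_E {γ : ℝ} {G : Set (ℝ × ℝ)} {a c : ℝ → ℝ}
    (h : ∀ᵐ p ∂volume.restrict (Eset γ), G.indicator (1 : ℝ × ℝ → ℝ) p = a p.2 ∧
      G.indicator (1 : ℝ × ℝ → ℝ) p = c p.1) :
    volume (Eset γ ∩ G) = 0 ∨ volume (Eset γ \ G) = 0 := by
  apply conn_ae volume (E_preconn γ)
  rintro ⟨u0, v0⟩ hp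
  obtain ⟨ε, hε, hb⟩ := Metric.isOpen_iff.1 (Eset_open γ) _ hp
  refine ⟨Metric.ball (u0, v0) ε, Metric.isOpen_ball, Metric.mem_ball_self hε, ?_⟩
  have h2 := ae_mono (Measure.restrict_mono hb le_rfl) h
  rw [← ball_prod_same, Measure.volume_eq_prod, ← Measure.prod_restrict] at h2
  have h3 := Measure.ae_ae_of_ae_prod h2
  have : NeBot (ae (volume.restrict (Metric.ball u0 ε))) := by
    rw [ae_neBot, Ne, Measure.restrict_eq_zero]
    exact (Metric.measure_ball_pos volume u0 hε).ne'
  obtain ⟨u1, hu1⟩ := h3.exists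
  have h4 : ∀ᵐ v ∂volume.restrict (Metric.ball v0 ε), a v = c u1 := by
    filter_upwards [hu1] with v hv
    exact hv.1.symm.trans hv.2
  have h5 : ∀ᵐ p ∂(volume.restrict (Metric.ball u0 ε)).prod (volume.restrict (Metric.ball v0 ε)),
      a p.2 = c u1 := Measure.quasiMeasurePreserving_snd.ae h4
  have h6 : ∀ᵐ p ∂volume.restrict (Metric.ball (u0, v0) ε), G.indicator (1 : ℝ × ℝ → ℝ) p = c u1 := by
    rw [← ball_prod_same, Measure.volume_eq_prod, ← Measure.prod_restrict]
    filter_upwards [h2, h5] with p hp1 hp2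
    exact hp1.1.trans hp2
  rw [ae_restrict_iff' Metric.isOpen_ball.measurableSet, ae_iff] at h6
  by_cases hk : c u1 = 1
  · right
    refine measure_mono_null ?_ h6
    rintro y ⟨y1, y2⟩ hy
    have := hy y1
    rw [indicator_of_notMem y2, hk] at this; norm_num at this
  · left
    refine measure_mono_null ?_ h6
    rintro y ⟨y1, y2⟩ hy
    have := hy y1
    rw [indicator_of_mem y2] at this; exact hk this.symm

lemma side {γ : ℝ} {H : Set ℝ} (mH : MeasurableSet H) (hH : m1 H = m1 Hᶜ) {G : Set (ℝ × ℝ)}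
    (mG : MeasurableSet G) (h : ∀ᵐ v, v ∈ Vs γ → Ty H {x | (ellMap γ v x, v) ∈ G}) :
    ∃ a b : ℝ → ℝ, Measurable a ∧ Measurable b ∧ (∀ v, |a v| ≤ 1) ∧ (∀ v, |b v| ≤ 1) ∧
      ∀ᵐ p ∂volume.restrict (Eset γ), G.indicator (1 : ℝ × ℝ → ℝ) p
        = a p.2 + b p.2 * sg H (ellInv γ p.2 p.1) := by
  have mi : Measurable (G.indicator (1 : ℝ × ℝ → ℝ)) := measurable_one.indicator mG
  have bi : ∀ p, |G.indicator (1 : ℝ × ℝ → ℝ) p| ≤ 1 := by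
    intro p
    by_cases hp : p ∈ G <;> simp [hp]
  have m1f : Measurable (fun p : ℝ × ℝ => G.indicator (1 : ℝ × ℝ → ℝ) (ellMap γ p.1 p.2, p.1)) :=
    mi.comp (ell_meas γ)
  have m2f : Measurable (fun p : ℝ × ℝ => G.indicator (1 : ℝ × ℝ → ℝ) (ellMap γ p.1 p.2, p.1) * sg H p.2) :=
    m1f.mul ((sg_meas mH).comp measurable_snd)
  have ma : Measurable (fun v => ∫ y, G.indicator (1 : ℝ × ℝ → ℝ) (ellMap γ v y, v) ∂m1) :=
    (m1f.stronglyMeasurable.integral_prod_right' (ν := m1)).measurable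
  have mb : Measurable (fun v => ∫ y, G.indicator (1 : ℝ × ℝ → ℝ) (ellMap γ v y, v) * sg H y ∂m1) :=
    (m2f.stronglyMeasurable.integral_prod_right' (ν := m1)).measurable
  refine ⟨_, _, ma, mb, ?_, ?_, ?_⟩
  · intro v
    have := norm_integral_le_of_norm_le_const (μ := m1) (C := 1)
      (f := fun y => G.indicator (1 : ℝ × ℝ → ℝ) (ellMap γ v y, v)) (.of_forall fun y => bi _)
    simpa using this
  · intro v
    have := norm_integral_le_of_norm_le_const (μ := m1) (C := 1)
      (f := fun y => G.indicator (1 : ℝ × ℝ → ℝ) (ellMap γ v y, v) * sg H y) (.of_forall fun y => by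
        rw [Real.norm_eq_abs, abs_mul]
        exact mul_le_one₀ (bi _) (abs_nonneg _) (sg_abs _ _))
    simpa using this
  · apply ae_of_lines
    · apply measurableSet_eq_fun mi
      refine (ma.comp measurable_snd).add ((mb.comp measurable_snd).mul ((sg_meas mH).comp ?_))
      unfold ellInv; fun_prop
    · filter_upwards [h] with v hv hvs
      filter_upwards [Ty_form mH hH (hv hvs)] with x hx
      simp only [ellInv_ellMap hvs]
      exact hx

lemma Ty_neg {H A : Set ℝ} (h : Ty H A) : Ty ((fun x => -x) ⁻¹' H) ((fun x => -x) ⁻¹' A) := by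
  have k := fun B (h : A =ᵐ[m1] B) => m1_neg.quasiMeasurePreserving.preimage_ae_eq h
  rcases h with h | h | h | h
  · exact Or.inl (k _ h)
  · exact Or.inr (Or.inl (k _ h))
  · exact Or.inr (Or.inr (Or.inl (k _ h)))
  · exact Or.inr (Or.inr (Or.inr (k _ h)))

/-- Core statement on the two slices. -/
lemma slices {γ : ℝ} (hs : Real.sin γ ≠ 0) (hc : Real.cos γ ≠ 0) {q : Kernel ℝ ℝ} [IsMarkovKernel q]
    (hrev : Reversible1 q) (herg : KErgodicMeasure m1 (fun x => q x)) {Fp Fm : Set (ℝ × ℝ)}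
    (mp : MeasurableSet Fp) (mm : MeasurableSet Fm) (sp : Fp ⊆ Eset γ) (sm : Fm ⊆ Eset γ)
    (h1 : ∀ᵐ p ∂volume.restrict (Eset γ), p ∈ Fm →
      q (-ellInv γ p.2 p.1) {x | (ellMap γ p.2 x, p.2) ∈ Fp} = 1)
    (h2 : ∀ᵐ p ∂volume.restrict (Eset γ), p ∈ Fp →
      q (-ellInv γ p.1 p.2) {x | (p.1, ellMap γ p.1 x) ∈ Fm} = 1) :
    volume Fm = volume Fp ∧ (volume Fp = 0 ∨ volume Fp = volume (Eset γ)) := by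
  have h2' : ∀ᵐ p ∂volume.restrict (Eset γ), p ∈ Prod.swap ⁻¹' Fp →
      q (-ellInv γ p.2 p.1) {x | (ellMap γ p.2 x, p.2) ∈ Prod.swap ⁻¹' Fm} = 1 := ae_swap h2
  have msw : MeasurePreserving (Prod.swap : ℝ × ℝ → ℝ × ℝ) volume volume :=
    Measure.measurePreserving_swap
  have vp : volume (Prod.swap ⁻¹' Fp) = volume Fp := msw.measure_preimage mp.nullMeasurableSet
  have vm : volume (Prod.swap ⁻¹' Fm) = volume Fm := msw.measure_preimage mm.nullMeasurableSet
  have mp' : MeasurableSet (Prod.swap ⁻¹' Fp) := measurable_swap mp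
  have mm' : MeasurableSet (Prod.swap ⁻¹' Fm) := measurable_swap mm
  have sp' : Prod.swap ⁻¹' Fp ⊆ Eset γ := fun p hp => Eset_swap.1 (sp hp)
  have sm' : Prod.swap ⁻¹' Fm ⊆ Eset γ := fun p hp => Eset_swap.1 (sm hp)
  have le1 := pair_le herg mm mp sm sp h1
  have le2 := pair_le herg mp' mm' sp' sm' h2'
  rw [vp, vm] at le2
  have e := le_antisymm le1 le2
  have fin : volume Fp ≠ ∞ := ((measure_mono sp).trans_lt (E_fin hs).lt_top).ne
  obtain ⟨H, mH, hH, hTy⟩ := exists_H hrev herg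
  have t1 := pair_Ty herg hTy mm mp sm sp h1 (by rw [e]; exact fin) e
  have t2 := pair_Ty herg hTy mp' mm' sp' sm' h2' (by rw [vp]; exact fin) (by rw [vp, vm, e])
  set H2 : Set ℝ := (fun x => -x) ⁻¹' H with hH2
  have mH2 : MeasurableSet H2 := measurable_neg mH
  have hH2' : m1 H2 = m1 H2ᶜ := by
    rw [hH2, ← preimage_compl, m1_neg.measure_preimage mH.nullMeasurableSet,
      m1_neg.measure_preimage mH.compl.nullMeasurableSet, hH]
  obtain ⟨a, b, ma, mb, ba, bb, i1⟩ := side mH hH mp (t1.mono fun v hv hvs => (hv hvs).2)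
  obtain ⟨c, d, mc, md, bc, bd, i2⟩ := side (γ := γ) mH2 hH2' mp' (by
    filter_upwards [t2] with v hv hvs
    have := Ty_neg (hv hvs).1
    simpa only [preimage_ofPred_eq, neg_neg] using this)
  have i2' : ∀ᵐ p ∂volume.restrict (Eset γ), Fp.indicator (1 : ℝ × ℝ → ℝ) p
        = c p.1 + d p.1 * sg H2 (ellInv γ p.1 p.2) := ae_swap i2
  have i1' : ∀ᵐ p ∂volume.restrict (Eset γ), (Prod.swap ⁻¹' Fp).indicator (1 : ℝ × ℝ → ℝ) p
        = a p.1 + b p.1 * sg H (ellInv γ p.1 p.2) := ae_swap i1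
  have zb := b_zero hs hc ma mb mc md mH mH2 hH ba bb bc bd (by
    filter_upwards [i1, i2'] with p h h'
    exact h.symm.trans h')
  have zd := b_zero hs hc mc md ma mb mH2 mH hH2' bc bd ba bb (by
    filter_upwards [i1', i2] with p h h'
    exact h'.symm.trans h)
  have tb : ∀ᵐ p ∂volume.restrict (Eset γ), b p.2 = 0 := by
    apply ae_of_lines (measurableSet_eq_fun (mb.comp measurable_snd) measurable_const)
    filter_upwards [zb] with v hv hvs
    filter_upwards with x using hv hvs
  have td0 : ∀ᵐ p ∂volume.restrict (Eset γ), d p.2 = 0 := by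
    apply ae_of_lines (measurableSet_eq_fun (md.comp measurable_snd) measurable_const)
    filter_upwards [zd] with v hv hvs
    filter_upwards with x using hv hvs
  have td : ∀ᵐ p ∂volume.restrict (Eset γ), d p.1 = 0 := ae_swap td0
  refine ⟨e, ?_⟩
  have := const_E (γ := γ) (G := Fp) (a := a) (c := c) (by
    filter_upwards [i1, i2', tb, td] with p k1 k2 k3 k4
    rw [k3, zero_mul, add_zero] at k1
    rw [k4, zero_mul, add_zero] at k2
    exact ⟨k1, k2⟩)
  rcases this with h | h
  · left; rwa [inter_eq_self_of_subset_right sp] at h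
  · right
    refine le_antisymm (measure_mono sp) ?_
    have := measure_sdiff_add_inter (μ := volume) (s := Eset γ) mp
    rw [h, zero_add, inter_eq_self_of_subset_right sp] at this
    exact this.ge

lemma m2_eq (γ : ℝ) (hs : Real.sin γ ≠ 0) : m2 γ = ((volume (Eset γ))⁻¹ * 2⁻¹) •
    ((volume.restrict (Eset γ)).map (fun p : ℝ × ℝ => (p.1, p.2, (1 : ℝ))) +
      (volume.restrict (Eset γ)).map (fun p : ℝ × ℝ => (p.1, p.2, (-1 : ℝ)))) := by
  have : IsFiniteMeasure (volume.restrict (Eset γ)) :=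
    ⟨by rw [Measure.restrict_apply_univ]; exact (E_fin hs).lt_top⟩
  unfold m2
  ext S hS
  have mf : Measurable (fun p : (ℝ × ℝ) × ℝ => (p.1.1, p.1.2, p.2)) := by fun_prop
  rw [Measure.map_apply mf hS, Measure.prod_apply (mf hS)]
  have g1 : Measurable (fun p : ℝ × ℝ => (p.1, p.2, (1 : ℝ))) := by fun_prop
  have g2 : Measurable (fun p : ℝ × ℝ => (p.1, p.2, (-1 : ℝ))) := by fun_prop
  have e : ∀ x : ℝ × ℝ, ((2 : ℝ≥0∞)⁻¹ • (Measure.dirac (1 : ℝ) + Measure.dirac (-1 : ℝ)))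
      (Prod.mk x ⁻¹' ((fun p : (ℝ × ℝ) × ℝ => (p.1.1, p.1.2, p.2)) ⁻¹' S)) =
      2⁻¹ * (((fun p : ℝ × ℝ => (p.1, p.2, (1 : ℝ))) ⁻¹' S).indicator 1 x +
        ((fun p : ℝ × ℝ => (p.1, p.2, (-1 : ℝ))) ⁻¹' S).indicator 1 x) := by
    intro x
    have mS : MeasurableSet (Prod.mk x ⁻¹' ((fun p : (ℝ × ℝ) × ℝ => (p.1.1, p.1.2, p.2)) ⁻¹' S)) :=
      measurable_prodMk_left (mf hS)
    rw [Measure.smul_apply, Measure.add_apply, Measure.dirac_apply' _ mS, Measure.dirac_apply' _ mS,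
      smul_eq_mul]
    rfl
  simp only [e]
  rw [lintegral_smul_measure, lintegral_const_mul _ (by
      exact (measurable_one.indicator (g1 hS)).add (measurable_one.indicator (g2 hS))),
    lintegral_add_left (measurable_one.indicator (g1 hS)), lintegral_indicator_one (g1 hS),
    lintegral_indicator_one (g2 hS), Measure.smul_apply, Measure.add_apply,
    Measure.map_apply g1 hS, Measure.map_apply g2 hS, smul_eq_mul, smul_eq_mul, mul_assoc]

lemma no_ergodic (γ : ℝ) (hγ : γ ∈ Ioo 0 Real.pi)
    (hirr : Irrational (γ / Real.pi))
    (q : Kernel ℝ ℝ) (hq : IsMarkovOnInterval q)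
    (hrev : Reversible1 q)
    (herg : KErgodicMeasure m1 (fun x => q x))
    (F : Set (ℝ × ℝ × ℝ)) (hFsub : F ⊆ EstarSet γ)
    (hF : KErgodicSet (m2 γ) (Qfun γ q) F)
    (h0 : 0 < m2 γ F) (h1 : m2 γ F < 1) : False := by
  have hs : Real.sin γ ≠ 0 := (Real.sin_pos_of_mem_Ioo hγ).ne'
  have hc : Real.cos γ ≠ 0 := by
    intro h
    rw [Real.cos_eq_zero_iff] at h
    obtain ⟨k, hk⟩ := h
    apply hirr
    refine ⟨(2 * k + 1) / 2, ?_⟩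
    rw [hk]
    push_cast
    field_simp
  have := hq.1
  have mF := hF.1
  have g1 : Measurable (fun p : ℝ × ℝ => (p.1, p.2, (1 : ℝ))) := by fun_prop
  have g2 : Measurable (fun p : ℝ × ℝ => (p.1, p.2, (-1 : ℝ))) := by fun_prop
  have mp : MeasurableSet (Fplus F) := g1 mF
  have mm : MeasurableSet (Fminus F) := g2 mF
  have sp : Fplus F ⊆ Eset γ := fun p hp => (hFsub hp).1
  have sm : Fminus F ⊆ Eset γ := fun p hp => (hFsub hp).1
  have hEf := E_fin hs
  have hE0 : volume (Eset γ) ≠ 0 :=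
    (Eset_open γ).measure_ne_zero volume ⟨(0, 0), by simp [Eset]⟩
  have hinv := hF.2.1
  unfold KInvariantSet at hinv
  have hne : (volume (Eset γ))⁻¹ * 2⁻¹ ≠ 0 :=
    mul_ne_zero (ENNReal.inv_ne_zero.2 hEf) (by simp)
  rw [m2_eq γ hs, Measure.ae_ennreal_smul_measure_iff hne, ae_add_measure_iff] at hinv
  have hp1 := ae_of_ae_map g1.aemeasurable hinv.1
  have hm1 := ae_of_ae_map g2.aemeasurable hinv.2
  have k := slices hs hc hrev herg mp mm sp sm (by
    filter_upwards [hm1] with p hp hpF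
    have := hp hpF
    simp only [Qfun, if_true] at this
    rwa [Measure.map_apply (by unfold ellMap; fun_prop) mF] at this) (by
    filter_upwards [hp1] with p hp hpF
    have := hp hpF
    simp only [Qfun] at this
    rw [if_neg (by norm_num)] at this
    rwa [Measure.map_apply (by unfold ellMap; fun_prop) mF] at this)
  have mF2 : m2 γ F = (volume (Eset γ))⁻¹ * 2⁻¹ * (volume (Fplus F) + volume (Fminus F)) := by
    rw [m2_eq γ hs, Measure.smul_apply, Measure.add_apply, Measure.map_apply g1 mF,
      Measure.map_apply g2 mF, smul_eq_mul]
    change _ * (volume.restrict (Eset γ) (Fplus F) + volume.restrict (Eset γ) (Fminus F)) = _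
    rw [Measure.restrict_eq_self _ sp, Measure.restrict_eq_self _ sm]
  rw [k.1, ← two_mul] at mF2
  rcases k.2 with hz | hz
  · rw [hz] at mF2; simp [mF2] at h0
  · rw [hz, mul_assoc, ← mul_assoc 2⁻¹, ENNReal.inv_mul_cancel (by simp) (by simp), one_mul,
      ENNReal.inv_mul_cancel hE0 hEf] at mF2
    rw [mF2] at h1
    exact lt_irrefl _ h1

/-- structure of `(m²,Q)`-ergodic sets of intermediate measure:
they are (up to null sets) preimages of subsets of `[-1,1]` under `V`, they partition
`E*` together with their `T₀`-image, and they have measure `1/2`. -/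
theorem ergodic_set_structure (γ : ℝ) (hγ : γ ∈ Ioo 0 Real.pi)
    (hirr : Irrational (γ / Real.pi))
    (q : Kernel ℝ ℝ) (hq : IsMarkovOnInterval q)
    (hrev : Reversible1 q)
    (herg : KErgodicMeasure m1 (fun x => q x))
    (F : Set (ℝ × ℝ × ℝ)) (hFsub : F ⊆ EstarSet γ)
    (hF : KErgodicSet (m2 γ) (Qfun γ q) F)
    (h0 : 0 < m2 γ F) (h1 : m2 γ F < 1) :
    (∃ K : Set ℝ, MeasurableSet K ∧ K ⊆ Icc (-1 : ℝ) 1 ∧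
      m2 γ ((F \ Vfun γ ⁻¹' K) ∪ (Vfun γ ⁻¹' K \ F)) = 0) ∧
    (m2 γ ((EstarSet γ \ (F ∪ T0 γ '' F)) ∪ ((F ∪ T0 γ '' F) \ EstarSet γ)) = 0 ∧
      m2 γ (F ∩ T0 γ '' F) = 0) ∧
    (m2 γ F = 1 / 2 ∧ m2 γ (T0 γ '' F) = 1 / 2) := by
  exact (no_ergodic γ hγ hirr q hq hrev herg F hFsub hF h0 h1).elim
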